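/- arXiv:1808.03343 — 9 statements merged into one kernel-verified Lean document; each statement's English description precedes it below -/
import Mathlib

section
/- Parseval's formula for the Mellin transform (Theorem 1): Let f, u : (0,∞) → ℂ be measurable and let υ ∈ ℝ. Assume (i) x ↦ x^{υ−1} f(x) is absolutely integrable on (0,∞), so that M[f](s) = ∫₀^∞ x^{s−1} f(x) dx exists for all s with Re s = υ; (ii) x ↦ x^{−υ} u(x) is absolutely integrable on (0,∞), so that M[u](1−s) exists for all s with Re s = υ; (iii) t ↦ M[f](υ+it) is absolutely integrable on ℝ and the Mellin inversion formula f(x) = (1/(2π)) ∫_ℝ M[f](υ+it) x^{−(υ+it)} dt holds for almost every x > 0. Then f·u is absolutely integrable on (0,∞) and ∫₀^∞ f(x) u(x) dx = (1/(2π)) ∫_ℝ M[f](υ+it) M[u](1−υ−it) dt. -/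
open MeasureTheory Complex Set Filter
open scoped Real

noncomputable section

/-- Data of a Fox H-kernel: integers `0 ≤ m ≤ q`, `0 ≤ n ≤ p`, real parameters
`a, b` and positive reals `A, B`. -/
structure FoxData where
  p : ℕ
  q : ℕ
  m : ℕ
  n : ℕ
  hm : m ≤ q
  hn : n ≤ p
  a : Fin p → ℝ
  A : Fin p → ℝ
  b : Fin q → ℝ
  B : Fin q → ℝ
  hA : ∀ i, 0 < A i
  hB : ∀ l, 0 < B l

/-- The Fox H-kernel
`Θ(s) = [∏_{l<m} Γ(b_l + B_l s) ∏_{i<n} Γ(1 − a_i − A_i s)] /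
        [∏_{m≤l} Γ(1 − b_l − B_l s) ∏_{n≤i} Γ(a_i + A_i s)]`. -/
noncomputable def FoxData.kernel (D : FoxData) (s : ℂ) : ℂ :=
  ((∏ l : Fin D.q, if l.val < D.m then Complex.Gamma ((D.b l : ℂ) + (D.B l : ℂ) * s) else 1) *
    (∏ i : Fin D.p, if i.val < D.n then Complex.Gamma (1 - (D.a i : ℂ) - (D.A i : ℂ) * s) else 1)) /
  ((∏ l : Fin D.q, if D.m ≤ l.val then Complex.Gamma (1 - (D.b l : ℂ) - (D.B l : ℂ) * s) else 1) *
    (∏ i : Fin D.p, if D.n ≤ i.val then Complex.Gamma ((D.a i : ℂ) + (D.A i : ℂ) * s) else 1))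

/-- The vertical line `Re s = c` contains no pole of the kernel, i.e. none of the
numerator Gamma factors is evaluated at a nonpositive integer on that line. -/
def FoxData.noPoleOn (D : FoxData) (c : ℝ) : Prop :=
  ∀ t : ℝ,
    (∀ l : Fin D.q, l.val < D.m → ∀ k : ℕ,
      (D.b l : ℂ) + (D.B l : ℂ) * ((c : ℂ) + (t : ℂ) * Complex.I) ≠ -(k : ℂ)) ∧
    (∀ i : Fin D.p, i.val < D.n → ∀ k : ℕ,
      1 - (D.a i : ℂ) - (D.A i : ℂ) * ((c : ℂ) + (t : ℂ) * Complex.I) ≠ -(k : ℂ))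

/-- `f` is a Fox H-function density with data `(κ, λ, Θ, c)`:
`κ, λ > 0`, `t ↦ Θ(c+it)` is absolutely integrable, the line `Re s = c` contains no
pole of `Θ`, `f(x) = (κ/(2π)) ∫_ℝ Θ(c+it) (λx)^{−(c+it)} dt` for `x > 0`, and `f` is a
probability density on `(0,∞)`. -/
def IsFoxDensity (f : ℝ → ℝ) (κ lam : ℝ) (D : FoxData) (c : ℝ) : Prop :=
  0 < κ ∧ 0 < lam ∧ Measurable f ∧
  Integrable (fun t : ℝ => D.kernel ((c : ℂ) + (t : ℂ) * Complex.I)) ∧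
  D.noPoleOn c ∧
  (∀ x : ℝ, 0 < x →
    (f x : ℂ) = (κ : ℂ) / (2 * (π : ℝ)) *
      ∫ t : ℝ, D.kernel ((c : ℂ) + (t : ℂ) * Complex.I) *
        ((lam * x : ℝ) : ℂ) ^ (-((c : ℂ) + (t : ℂ) * Complex.I))) ∧
  (∀ x, 0 ≤ f x) ∧ (∫ x in Ioi (0 : ℝ), f x = 1)

/-- The CCDF representation holds for `f` (with data `(κ, λ, Θ, ·)`) at level `σ' > 0`:
`∫_x^∞ f(u) du = (κ/(2πλ)) ∫_ℝ [Θ(1+ξ)/ξ] (λx)^{−ξ} dt` for all `x > 0`, `ξ = σ' + it`. -/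
def HasCCDFRep (f : ℝ → ℝ) (κ lam : ℝ) (D : FoxData) (σ' : ℝ) : Prop :=
  0 < σ' ∧ ∀ x : ℝ, 0 < x →
    ((∫ u in Ioi x, f u : ℝ) : ℂ) = (κ : ℂ) / (2 * (π : ℝ) * lam) *
      ∫ t : ℝ, (D.kernel (1 + ((σ' : ℂ) + (t : ℂ) * Complex.I)) /
          ((σ' : ℂ) + (t : ℂ) * Complex.I)) *
        ((lam * x : ℝ) : ℂ) ^ (-((σ' : ℂ) + (t : ℂ) * Complex.I))

/-- The random variable `X` has probability density `f` (w.r.t. Lebesgue measure). -/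
def HasDensity {Ω : Type*} [MeasurableSpace Ω] (μ : Measure Ω) (X : Ω → ℝ) (f : ℝ → ℝ) : Prop :=
  Measurable X ∧ Measure.map X μ = volume.withDensity (fun x => ENNReal.ofReal (f x))

/-- The integrand of the double integral obtained by inserting the inverse Mellin transform
into `∫ f u` is absolutely integrable. -/
theorem integrable_mul_cpow_mul_prod {g u : ℝ → ℂ} {υ : ℝ} (hg : Integrable g)
    (hu : IntegrableOn (fun x : ℝ => ((x ^ (-υ) : ℝ) : ℂ) * u x) (Ioi 0)) :
    Integrable (fun z : ℝ × ℝ =>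
        g z.2 * (z.1 : ℂ) ^ (-((υ : ℂ) + (z.2 : ℂ) * Complex.I)) * u z.1)
      ((volume.restrict (Ioi (0 : ℝ))).prod volume) := by
  have hpos : ∀ᵐ z ∂((volume.restrict (Ioi (0 : ℝ))).prod (volume : Measure ℝ)), 0 < z.1 :=
    Measure.quasiMeasurePreserving_fst.ae (ae_restrict_mem measurableSet_Ioi)
  have hmeas : Measurable fun z : ℝ × ℝ => (z.1 : ℂ) ^ (-((z.2 : ℂ) * Complex.I)) := by
    fun_prop
  have hprod := (hu.mul_prod hg).bdd_mul (c := 1) hmeas.aestronglyMeasurable (by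
    filter_upwards [hpos] with z hz
    rw [norm_cpow_eq_rpow_re_of_pos hz]
    simp)
  refine hprod.congr ?_
  filter_upwards [hpos] with z hz
  rw [neg_add, cpow_add _ _ (ofReal_ne_zero.mpr hz.ne'), ofReal_cpow hz.le, ofReal_neg]
  ring

/-- The Mellin transform at the reflected point `1 - s`. -/
theorem mellin_one_sub (u : ℝ → ℂ) (s : ℂ) :
    mellin u (1 - s) = ∫ x in Ioi (0 : ℝ), (x : ℂ) ^ (-s) * u x := by
  simp only [mellin, smul_eq_mul, sub_sub_cancel_left]

/-- **Parseval's formula for the Mellin transform.**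
If `x ↦ x^{υ−1} f(x)` and `x ↦ x^{−υ} u(x)` are absolutely integrable on `(0,∞)`,
`t ↦ M[f](υ+it)` is absolutely integrable on `ℝ` and the Mellin inversion formula for `f`
holds a.e. on `(0,∞)`, then `f·u` is absolutely integrable on `(0,∞)` and
`∫₀^∞ f u = (1/(2π)) ∫_ℝ M[f](υ+it) M[u](1−υ−it) dt`. -/
theorem mellin_parseval (f u : ℝ → ℂ) (hf : Measurable f) (hu : Measurable u) (υ : ℝ)
    (hfInt : IntegrableOn (fun x : ℝ => ((x ^ (υ - 1) : ℝ) : ℂ) * f x) (Ioi 0))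
    (huInt : IntegrableOn (fun x : ℝ => ((x ^ (-υ) : ℝ) : ℂ) * u x) (Ioi 0))
    (hMInt : Integrable (fun t : ℝ => mellin f ((υ : ℂ) + (t : ℂ) * Complex.I)))
    (hInv : ∀ᵐ x ∂(volume.restrict (Ioi (0 : ℝ))),
      f x = 1 / (2 * (π : ℝ)) *
        ∫ t : ℝ, mellin f ((υ : ℂ) + (t : ℂ) * Complex.I) *
          ((x : ℂ) ^ (-((υ : ℂ) + (t : ℂ) * Complex.I)))) :
    IntegrableOn (fun x : ℝ => f x * u x) (Ioi 0) ∧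
      ∫ x in Ioi (0 : ℝ), f x * u x = 1 / (2 * (π : ℝ)) *
        ∫ t : ℝ, mellin f ((υ : ℂ) + (t : ℂ) * Complex.I) *
          mellin u (1 - (υ : ℂ) - (t : ℂ) * Complex.I) := by
  set g : ℝ → ℂ := fun t => mellin f ((υ : ℂ) + (t : ℂ) * Complex.I)
  have hK := integrable_mul_cpow_mul_prod hMInt huInt
  have hfu : (fun x : ℝ => f x * u x) =ᵐ[volume.restrict (Ioi (0 : ℝ))] fun x =>
      1 / (2 * (π : ℝ)) *
        ∫ t : ℝ, g t * (x : ℂ) ^ (-((υ : ℂ) + (t : ℂ) * Complex.I)) * u x := by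
    filter_upwards [hInv] with x hx
    rw [integral_mul_const, ← mul_assoc, ← hx]
  refine ⟨(hK.integral_prod_left.const_mul _).congr hfu.symm, ?_⟩
  rw [integral_congr_ae hfu, integral_const_mul, integral_integral_swap hK]
  congr 2
  ext t
  simp only [mul_assoc]
  rw [integral_const_mul, sub_sub, mellin_one_sub]
end
end

section
/- CDF of a Fox H-function distribution (eq. (3a)): Let f be a Fox H-function density with data (κ, λ, Θ, c) where 0 < c < 1, and let X be a nonnegative random variable with probability density f. Then for every x > 0, Pr(X ≤ x) = (κ/(2π)) ∫_ℝ Θ(c+it) λ^{−(c+it)} x^{1−(c+it)} / (1−(c+it)) dt. -/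
open MeasureTheory Complex Set Filter
open scoped Real

noncomputable section

/-- The map `(u, t) ↦ u ^ (-(c + it)) K(t)` is integrable on `(0, x] × ℝ`. -/
lemma integrable_prod_cpow_mul {K : ℝ → ℂ} (hK : Integrable K) {c : ℝ} (hc : c < 1) {x : ℝ}
    (hx : 0 < x) :
    Integrable (fun p : ℝ × ℝ => (p.1 : ℂ) ^ (-((c : ℂ) + (p.2 : ℂ) * Complex.I)) * K p.2)
      ((volume.restrict (Ioc 0 x)).prod volume) := by
  have hg : Integrable (fun u : ℝ => u ^ (-c)) (volume.restrict (Ioc 0 x)) :=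
    (intervalIntegrable_iff_integrableOn_Ioc_of_le hx.le).1
      (intervalIntegral.intervalIntegrable_rpow' (by linarith))
  refine (hg.mul_prod hK.norm).mono' ?_ ?_
  · refine AEStronglyMeasurable.mul (Measurable.aestronglyMeasurable (by fun_prop)) ?_
    exact hK.aestronglyMeasurable.comp_snd
  · have hpos : ∀ᵐ u ∂(volume.restrict (Ioc 0 x)), u ∈ Ioc 0 x :=
      ae_restrict_mem measurableSet_Ioc
    filter_upwards [Measure.quasiMeasurePreserving_fst.ae hpos] with p hp
    rw [norm_mul, Complex.norm_cpow_eq_rpow_re_of_pos hp.1]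
    simp

/-- Primitive on `(0, x]` of an integral of powers along a vertical line. -/
lemma integral_Ioc_integral_cpow_mul {K : ℝ → ℂ} (hK : Integrable K) {c : ℝ} (hc : c < 1)
    {x : ℝ} (hx : 0 < x) :
    ∫ u in Ioc 0 x, ∫ t : ℝ, (u : ℂ) ^ (-((c : ℂ) + (t : ℂ) * Complex.I)) * K t =
      ∫ t : ℝ, (x : ℂ) ^ (1 - ((c : ℂ) + (t : ℂ) * Complex.I)) /
        (1 - ((c : ℂ) + (t : ℂ) * Complex.I)) * K t := by
  rw [integral_integral_swap (integrable_prod_cpow_mul hK hc hx)]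
  refine integral_congr_ae (Eventually.of_forall fun t => ?_)
  have hre : -1 < (-((c : ℂ) + (t : ℂ) * Complex.I)).re := by simpa using hc
  have hne : -((c : ℂ) + (t : ℂ) * Complex.I) + 1 ≠ 0 := by
    intro h
    have := congrArg Complex.re h
    simp at this
    linarith
  simp only
  rw [integral_mul_const, ← intervalIntegral.integral_of_le hx.le, integral_cpow (Or.inl hre),
    Complex.ofReal_zero, Complex.zero_cpow hne, sub_zero, neg_add_eq_sub]

/-- The distribution function of a nonnegative random variable with density `f` is the integral
of `f` over `(0, x]`. -/
lemma HasDensity.toReal_measure_le {Ω : Type*} [MeasurableSpace Ω] {μ : Measure Ω} {X : Ω → ℝ}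
    {f : ℝ → ℝ} (hXf : HasDensity μ X f) (hX0 : ∀ ω, 0 ≤ X ω) (hfm : Measurable f)
    (hf0 : ∀ x, 0 ≤ f x) (x : ℝ) :
    (μ {ω | X ω ≤ x}).toReal = ∫ u in Ioc 0 x, f u := by
  have h1 : {ω | X ω ≤ x} = X ⁻¹' Icc 0 x := by
    ext ω
    simp [hX0 ω]
  rw [h1, ← Measure.map_apply hXf.1 measurableSet_Icc, hXf.2,
    withDensity_apply _ measurableSet_Icc, restrict_Ioc_eq_restrict_Icc.symm,
    integral_eq_lintegral_of_nonneg_ae (Eventually.of_forall hf0) hfm.aestronglyMeasurable]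

/-- **CDF of a Fox H-function distribution (eq. (3a)).**
If `f` is a Fox H-function density with data `(κ, λ, Θ, c)`, `0 < c < 1`, and `X` is a
nonnegative random variable with density `f`, then for every `x > 0`,
`Pr(X ≤ x) = (κ/(2π)) ∫_ℝ Θ(c+it) λ^{−(c+it)} x^{1−(c+it)}/(1−(c+it)) dt`. -/
theorem cdf_of_foxDensity {Ω : Type*} [MeasurableSpace Ω] (μ : Measure Ω)
    [IsProbabilityMeasure μ] (X : Ω → ℝ) (hX0 : ∀ ω, 0 ≤ X ω)
    (f : ℝ → ℝ) (κ lam c : ℝ) (D : FoxData)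
    (hf : IsFoxDensity f κ lam D c) (hc0 : 0 < c) (hc1 : c < 1)
    (hXf : HasDensity μ X f) :
    ∀ x : ℝ, 0 < x →
      ((μ {ω | X ω ≤ x}).toReal : ℂ) = (κ : ℂ) / (2 * (π : ℝ)) *
        ∫ t : ℝ, D.kernel ((c : ℂ) + (t : ℂ) * Complex.I) *
          (lam : ℂ) ^ (-((c : ℂ) + (t : ℂ) * Complex.I)) *
          (x : ℂ) ^ (1 - ((c : ℂ) + (t : ℂ) * Complex.I)) /
          (1 - ((c : ℂ) + (t : ℂ) * Complex.I)) := by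
  intro x hx
  obtain ⟨-, hl, hfm, hK, -, hrep, hf0, -⟩ := hf
  have hL : Integrable (fun t : ℝ => (lam : ℂ) ^ (-((c : ℂ) + (t : ℂ) * Complex.I)) *
      D.kernel ((c : ℂ) + (t : ℂ) * Complex.I)) := by
    refine hK.bdd_mul (c := lam ^ (-c)) (Measurable.aestronglyMeasurable (by fun_prop))
      (Eventually.of_forall fun t => ?_)
    rw [Complex.norm_cpow_eq_rpow_re_of_pos hl]
    simp
  rw [hXf.toReal_measure_le hX0 hfm hf0, ← integral_complex_ofReal,
    setIntegral_congr_fun measurableSet_Ioc (fun u hu => hrep u hu.1), integral_const_mul]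
  congr 1
  calc _ = ∫ u in Ioc 0 x, ∫ t : ℝ, (u : ℂ) ^ (-((c : ℂ) + (t : ℂ) * Complex.I)) *
        ((lam : ℂ) ^ (-((c : ℂ) + (t : ℂ) * Complex.I)) *
          D.kernel ((c : ℂ) + (t : ℂ) * Complex.I)) := by
        refine setIntegral_congr_fun measurableSet_Ioc fun u hu => ?_
        refine integral_congr_ae (Eventually.of_forall fun t => ?_)
        simp only
        rw [Complex.ofReal_mul, Complex.mul_cpow_ofReal_nonneg hl.le hu.1.le]
        ring
    _ = _ := by
        rw [integral_Ioc_integral_cpow_mul hL hc1 hx]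
        refine integral_congr_ae (Eventually.of_forall fun t => ?_)
        simp only
        ring
end
end

section
/- Mellin transform of ln(1+x): For every s ∈ ℂ with −1 < Re s < 0, the integral ∫₀^∞ x^{s−1} ln(1+x) dx converges absolutely and equals π / (s sin(πs)). -/
open MeasureTheory Complex Set Filter
open scoped Real

noncomputable section

theorem image_div_one_sub_Ioo :
    (fun x : ℝ => x / (1 - x)) '' Ioo 0 1 = Ioi 0 := by
  ext y
  simp only [mem_image, mem_Ioo, mem_Ioi]
  constructor
  · rintro ⟨x, ⟨h0, h1⟩, rfl⟩
    exact div_pos h0 (by linarith)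
  · intro hy
    refine ⟨y / (1 + y), ⟨by positivity, (div_lt_one (by positivity)).2 (by linarith)⟩, ?_⟩
    have : 1 + y ≠ 0 := by positivity
    field_simp
    ring

theorem injOn_div_one_sub_Ioo : InjOn (fun x : ℝ => x / (1 - x)) (Ioo 0 1) := by
  intro x hx y hy h
  have hx1 : 1 - x ≠ 0 := by linarith [hx.2]
  have hy1 : 1 - y ≠ 0 := by linarith [hy.2]
  simp only [div_eq_div_iff hx1 hy1] at h
  linarith

theorem hasDerivAt_div_one_sub {x : ℝ} (hx : x ≠ 1) :
    HasDerivAt (fun x : ℝ => x / (1 - x)) (1 / (1 - x) ^ 2) x := by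
  have h1 : 1 - x ≠ 0 := sub_ne_zero.2 hx.symm
  convert! (hasDerivAt_id x).div ((hasDerivAt_id x).const_sub 1) h1 using 1
  simp

/-- The Euler integral `∫₀^∞ x^{u−1}/(1+x) dx = π / sin(πu)` for `0 < Re u < 1`. -/
theorem integral_cpow_mul_inv_one_add {u : ℂ} (h0 : 0 < u.re) (h1 : u.re < 1) :
    ∫ x in Ioi (0 : ℝ), (x : ℂ) ^ (u - 1) * (1 + (x : ℂ))⁻¹ = π / Complex.sin (π * u) := by
  rw [← Complex.Gamma_mul_Gamma_one_sub]
  have hbeta := Complex.betaIntegral_eq_Gamma_mul_div u (1 - u) h0 (by simpa using h1)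
  rw [add_sub_cancel, Complex.Gamma_one, div_one] at hbeta
  rw [← hbeta, Complex.betaIntegral, intervalIntegral.integral_of_le zero_le_one,
    integral_Ioc_eq_integral_Ioo, ← image_div_one_sub_Ioo,
    integral_image_eq_integral_abs_deriv_smul measurableSet_Ioo
      (fun x hx => (hasDerivAt_div_one_sub hx.2.ne).hasDerivWithinAt) injOn_div_one_sub_Ioo]
  refine setIntegral_congr_fun measurableSet_Ioo fun x hx => ?_
  have hx1 : 0 < 1 - x := sub_pos.2 hx.2
  have hne : (1 : ℂ) - x ≠ 0 := by exact_mod_cast hx1.ne'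
  have hpow : (1 - (x : ℂ)) ^ (1 - u - 1) * (1 - (x : ℂ)) ^ (u - 1) = (1 - (x : ℂ))⁻¹ := by
    rw [← Complex.cpow_add _ _ hne, ← Complex.cpow_neg_one]
    congr 1
    ring
  have hpow_ne : (1 - (x : ℂ)) ^ (u - 1) ≠ 0 := by simp [Complex.cpow_eq_zero_iff, hne]
  have hdiv : ((x / (1 - x) : ℝ) : ℂ) ^ (u - 1) =
      (x : ℂ) ^ (u - 1) / (1 - (x : ℂ)) ^ (u - 1) := by
    rw [div_eq_mul_inv, Complex.ofReal_mul,
      Complex.mul_cpow_ofReal_nonneg hx.1.le (inv_nonneg.2 hx1.le), Complex.ofReal_inv,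
      Complex.inv_cpow _ _ (by
        rw [Complex.arg_ofReal_of_nonneg hx1.le]; exact Real.pi_pos.ne), ← div_eq_mul_inv]
    push_cast
    rfl
  have hinv : (1 + ((x / (1 - x) : ℝ) : ℂ))⁻¹ = 1 - (x : ℂ) := by
    push_cast
    field_simp
    ring
  simp only [abs_of_pos (show 0 < 1 / (1 - x) ^ 2 by positivity), hdiv, hinv,
    Complex.real_smul, eq_div_of_mul_eq hpow_ne hpow]
  push_cast
  field_simp

/-- Sublinear power bounds for the logarithm, simultaneously useful at `0` and at `∞`. -/
theorem log_one_add_le_rpow_div {x ε : ℝ} (hx : 0 ≤ x) (h0 : 0 < ε) (h1 : ε ≤ 1) :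
    Real.log (1 + x) ≤ x ^ ε / ε := by
  rw [le_div_iff₀ h0, mul_comm, ← Real.log_rpow (by positivity)]
  have hsub : (1 + x) ^ ε ≤ 1 + x ^ ε := by
    simpa using Real.rpow_add_le_add_rpow zero_le_one hx h0.le h1
  have := Real.log_le_sub_one_of_pos (show 0 < (1 + x) ^ ε by positivity)
  linarith

theorem norm_log_one_add_le_rpow_div {x ε : ℝ} (hx : 0 ≤ x) (h0 : 0 < ε) (h1 : ε ≤ 1) :
    ‖(Real.log (1 + x) : ℂ)‖ ≤ x ^ ε / ε := by
  rw [Complex.norm_of_nonneg (Real.log_nonneg (by linarith))]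
  exact log_one_add_le_rpow_div hx h0 h1

theorem mellinConvergent_log_one_add {s : ℂ} (hs1 : -1 < s.re) (hs0 : s.re < 0) :
    MellinConvergent (fun x : ℝ => (Real.log (1 + x) : ℂ)) s := by
  have hbound (ε : ℝ) (h0 : 0 < ε) (h1 : ε ≤ 1) {x : ℝ} (hx : 0 < x) :
      ‖(Real.log (1 + x) : ℂ)‖ ≤ ε⁻¹ * ‖x ^ (-(-ε))‖ := by
    rw [neg_neg, Real.norm_of_nonneg (by positivity), inv_mul_eq_div]
    exact norm_log_one_add_le_rpow_div hx.le h0 h1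
  refine mellinConvergent_of_isBigO_rpow (a := -(-s.re / 2)) (b := -1) ?_
    (.of_bound (-s.re / 2)⁻¹ ?_) (by linarith) (.of_bound 1⁻¹ ?_) hs1
  · refine ContinuousOn.locallyIntegrableOn (fun x hx => ?_) measurableSet_Ioi
    have : 1 + x ≠ 0 := by linarith [mem_Ioi.1 hx]
    exact (by fun_prop (disch := assumption) : ContinuousAt _ x).continuousWithinAt
  · filter_upwards [eventually_gt_atTop 0] with x hx
    exact hbound _ (by linarith) (by linarith) hx
  · filter_upwards [self_mem_nhdsWithin] with x hx
    exact hbound 1 one_pos le_rfl hx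

theorem mellinConvergent_inv_one_add {u : ℂ} (h0 : 0 < u.re) (h1 : u.re < 1) :
    MellinConvergent (fun x : ℝ => (1 + (x : ℂ))⁻¹) u := by
  have hnorm {x : ℝ} (hx : 0 < x) : ‖(1 + (x : ℂ))⁻¹‖ = (1 + x)⁻¹ := by
    rw [norm_inv, ← Complex.ofReal_one, ← Complex.ofReal_add,
      Complex.norm_of_nonneg (by positivity)]
  refine mellinConvergent_of_isBigO_rpow (a := 1) (b := 0) ?_
    (.of_bound 1 ?_) h1 (.of_bound 1 ?_) h0
  · refine ContinuousOn.locallyIntegrableOn (fun x hx => ?_) measurableSet_Ioi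
    have : 1 + (x : ℂ) ≠ 0 := by
      have : 1 + x ≠ 0 := by linarith [mem_Ioi.1 hx]
      exact_mod_cast this
    exact (by fun_prop (disch := assumption) : ContinuousAt _ x).continuousWithinAt
  · filter_upwards [eventually_gt_atTop 0] with x hx
    rw [hnorm hx, Real.rpow_neg_one, one_mul, Real.norm_of_nonneg (by positivity)]
    gcongr
    linarith
  · filter_upwards [self_mem_nhdsWithin] with x hx
    rw [hnorm hx]
    simpa using inv_le_one_of_one_le₀ (by linarith [mem_Ioi.1 hx] : 1 ≤ 1 + x)

theorem norm_log_one_add_mul_cpow_le {s : ℂ} {x ε : ℝ} (hx : 0 < x) (h0 : 0 < ε) (h1 : ε ≤ 1) :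
    ‖(Real.log (1 + x) : ℂ) * ((x : ℂ) ^ s / s)‖ ≤ x ^ (ε + s.re) / (ε * ‖s‖) := by
  rw [norm_mul, norm_div, Complex.norm_cpow_eq_rpow_re_of_pos hx, Real.rpow_add hx,
    mul_div_mul_comm]
  gcongr
  exact norm_log_one_add_le_rpow_div hx.le h0 h1

theorem tendsto_log_one_add_mul_cpow_zero {s : ℂ} (hs : -1 < s.re) :
    Tendsto (fun x : ℝ => (Real.log (1 + x) : ℂ) * ((x : ℂ) ^ s / s))
      (nhdsWithin 0 (Ioi 0)) (nhds 0) := by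
  have hpow : Tendsto (fun x : ℝ => x ^ (1 + s.re) / (1 * ‖s‖)) (nhdsWithin 0 (Ioi 0))
      (nhds 0) := by
    have hpos : 0 < 1 + s.re := by linarith
    have h := (Real.continuousAt_rpow_const 0 (1 + s.re) (.inr hpos.le)).tendsto
    rw [Real.zero_rpow hpos.ne'] at h
    simpa using (h.mono_left nhdsWithin_le_nhds).div_const (1 * ‖s‖)
  refine squeeze_zero_norm' ?_ hpow
  filter_upwards [self_mem_nhdsWithin] with x hx
  exact norm_log_one_add_mul_cpow_le hx one_pos le_rfl

theorem tendsto_log_one_add_mul_cpow_atTop {s : ℂ} (hs1 : -1 < s.re) (hs0 : s.re < 0) :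
    Tendsto (fun x : ℝ => (Real.log (1 + x) : ℂ) * ((x : ℂ) ^ s / s)) atTop (nhds 0) := by
  have hpow : Tendsto (fun x : ℝ => x ^ (-s.re / 2 + s.re) / (-s.re / 2 * ‖s‖)) atTop
      (nhds 0) := by
    have h := tendsto_rpow_neg_atTop (show 0 < -s.re / 2 by linarith)
    rw [show -(-s.re / 2) = -s.re / 2 + s.re by ring] at h
    simpa using h.div_const (-s.re / 2 * ‖s‖)
  refine squeeze_zero_norm' ?_ hpow
  filter_upwards [eventually_gt_atTop 0] with x hx
  exact norm_log_one_add_mul_cpow_le hx (by linarith) (by linarith)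

/-- **Mellin transform of `ln(1+x)`.**
For every `s ∈ ℂ` with `−1 < Re s < 0`, the integral `∫₀^∞ x^{s−1} ln(1+x) dx`
converges absolutely and equals `π / (s sin(πs))`. -/
theorem mellin_log_one_add (s : ℂ) (hs1 : -1 < s.re) (hs0 : s.re < 0) :
    IntegrableOn (fun x : ℝ => (x : ℂ) ^ (s - 1) * (Real.log (1 + x) : ℂ)) (Ioi 0) ∧
      ∫ x in Ioi (0 : ℝ), (x : ℂ) ^ (s - 1) * (Real.log (1 + x) : ℂ) =
        (π : ℝ) / (s * Complex.sin ((π : ℝ) * s)) := by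
  have hs : s ≠ 0 := by
    rintro rfl
    simp at hs0
  have hint := mellinConvergent_log_one_add hs1 hs0
  have hu0 : 0 < (s + 1).re := by simpa using by linarith
  have hu1 : (s + 1).re < 1 := by simpa using hs0
  have hint' := mellinConvergent_inv_one_add hu0 hu1
  have heuler := integral_cpow_mul_inv_one_add hu0 hu1
  simp only [MellinConvergent, smul_eq_mul, add_sub_cancel_right] at hint hint' heuler
  refine ⟨hint, ?_⟩
  have hlog (x : ℝ) (hx : x ∈ Ioi (0 : ℝ)) :
      HasDerivAt (fun x : ℝ => (Real.log (1 + x) : ℂ)) ((1 + (x : ℂ))⁻¹) x := by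
    have hx1 : 1 + x ≠ 0 := by linarith [mem_Ioi.1 hx]
    simpa using (((hasDerivAt_id x).const_add 1).log hx1).ofReal_comp
  have hcpow (x : ℝ) (hx : x ∈ Ioi (0 : ℝ)) :
      HasDerivAt (fun x : ℝ => (x : ℂ) ^ s / s) ((x : ℂ) ^ (s - 1)) x := by
    simpa [hs] using (hasDerivAt_ofReal_cpow_const (mem_Ioi.1 hx).ne' hs).div_const s
  have hswap (x : ℝ) :
      (1 + (x : ℂ))⁻¹ * ((x : ℂ) ^ s / s) = (x : ℂ) ^ s * (1 + (x : ℂ))⁻¹ / s := by ring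
  have hparts := integral_Ioi_mul_deriv_eq_deriv_mul hlog hcpow
    (hint.congr_fun (fun x _ => mul_comm _ _) measurableSet_Ioi)
    (IntegrableOn.congr_fun (hint'.div_const s) (fun x _ => (hswap x).symm)
      measurableSet_Ioi)
    (tendsto_log_one_add_mul_cpow_zero hs1) (tendsto_log_one_add_mul_cpow_atTop hs1 hs0)
  simp only [mul_comm (Complex.ofReal (Real.log _))] at hparts
  simp only [hparts, hswap]
  rw [integral_div, heuler, mul_add, mul_one, Complex.sin_add_pi, sub_self, zero_sub, div_neg,
    neg_div, neg_neg, div_div, mul_comm s]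
end
end

section
/- Mellin transform of the shifted complementary CDF (eq. (34)): Let f_B be a Fox H-function density with data (κ_B, λ_B, Θ_B, c_B) for which the CCDF representation holds at some level σ' > 0, and write F̄_B(x) = ∫_x^∞ f_B(u) du. Let R_s > 1, W = R_s − 1, and let s ∈ ℂ with Re s < 1 and σ' + Re s > 1. If the corresponding iterated integrals converge absolutely (so Fubini's theorem applies), then ∫₀^∞ γ^{−s} F̄_B(R_s γ + W) dγ = (κ_B/λ_B) Γ(1−s) (R_s/W)^{s−1} · (1/(2π)) ∫_ℝ [Γ(ξ+s−1)/(ξ Γ(ξ))] Θ_B(1+ξ) (λ_B W)^{−ξ} dt, where ξ = σ' + it. -/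
open MeasureTheory Complex Set Filter
open scoped Real

noncomputable section

/-- The beta prime integral: `∫₀^∞ y^{u-1} (1+y)^{-(u+v)} dy = B(u, v)`. -/
theorem integral_Ioi_cpow_mul_one_add_cpow (u v : ℂ) :
    ∫ y in Ioi (0 : ℝ), (y : ℂ) ^ (u - 1) * ((1 + y : ℝ) : ℂ) ^ (-(u + v)) =
      betaIntegral u v := by
  have himage : (fun x : ℝ => x / (1 - x)) '' Ioo 0 1 = Ioi 0 := by
    ext y
    simp only [mem_image, mem_Ioo, mem_Ioi]
    constructor
    · rintro ⟨x, ⟨hx0, hx1⟩, rfl⟩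
      exact div_pos hx0 (by linarith)
    · intro hy
      have hy' : 0 < 1 + y := by linarith
      refine ⟨y / (1 + y), ⟨div_pos hy hy', (div_lt_one hy').2 (by linarith)⟩, ?_⟩
      field_simp
      ring
  have hderiv : ∀ x ∈ Ioo (0 : ℝ) 1,
      HasDerivWithinAt (fun x : ℝ => x / (1 - x)) (1 / (1 - x) ^ 2) (Ioo 0 1) x := by
    intro x hx
    have hx1 : 1 - x ≠ 0 := by linarith [hx.2]
    have h := (hasDerivAt_id' x).fun_div ((hasDerivAt_id' x).const_sub 1) hx1
    rw [show 1 * (1 - x) - x * -1 = 1 by ring] at h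
    exact h.hasDerivWithinAt
  have hinj : InjOn (fun x : ℝ => x / (1 - x)) (Ioo 0 1) := by
    intro x hx y hy hxy
    have hx1 : 1 - x ≠ 0 := by linarith [hx.2]
    have hy1 : 1 - y ≠ 0 := by linarith [hy.2]
    simp only at hxy
    rw [div_eq_div_iff hx1 hy1] at hxy
    linarith
  rw [← himage, integral_image_eq_integral_abs_deriv_smul measurableSet_Ioo hderiv hinj,
    betaIntegral, intervalIntegral.integral_of_le zero_le_one, integral_Ioc_eq_integral_Ioo]
  refine setIntegral_congr_fun measurableSet_Ioo fun x hx => ?_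
  have hx1 : 0 < 1 - x := by linarith [hx.2]
  have hxc : ((1 - x : ℝ) : ℂ) ≠ 0 := by exact_mod_cast hx1.ne'
  have hsum : 1 + x / (1 - x) = (1 - x)⁻¹ := by field_simp; ring
  have hsq : ((|1 / (1 - x) ^ 2| : ℝ) : ℂ) = ((1 - x : ℝ) : ℂ) ^ (-2 : ℂ) := by
    rw [abs_of_pos (by positivity), cpow_neg, cpow_ofNat]
    push_cast
    simp
  have hinv : ∀ z : ℂ, (((1 - x)⁻¹ : ℝ) : ℂ) ^ z = ((1 - x : ℝ) : ℂ) ^ (-z) := by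
    intro z
    rw [ofReal_inv, inv_cpow_eq_ite, if_neg, cpow_neg]
    rw [arg_ofReal_of_nonneg hx1.le]
    exact Real.pi_pos.ne
  have hpow : ((1 - x : ℝ) : ℂ) ^ (v - 1) = ((1 - x : ℝ) : ℂ) ^ (-2 : ℂ) *
      (((1 - x : ℝ) : ℂ) ^ (-(u - 1)) * ((1 - x : ℝ) : ℂ) ^ (u + v)) := by
    rw [← cpow_add _ _ hxc, ← cpow_add _ _ hxc]
    ring_nf
  simp only [real_smul]
  rw [hsq, hsum, hinv, neg_neg, div_eq_mul_inv, ofReal_mul,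
    mul_cpow_ofReal_nonneg hx.1.le (inv_nonneg.2 hx1.le), hinv,
    show (1 : ℂ) - (x : ℂ) = ((1 - x : ℝ) : ℂ) by push_cast; rfl, hpow]
  ring

/-- The Mellin transform of a shifted power `(λ(rγ + w))^{-ξ}`. -/
theorem integral_Ioi_cpow_mul_affine_cpow {lam r w : ℝ} (hlam : 0 < lam) (hr : 0 < r)
    (hw : 0 < w) {s ξ : ℂ} (hs : s.re < 1) (hξ : 1 < ξ.re + s.re) :
    ∫ γ in Ioi (0 : ℝ), (γ : ℂ) ^ (-s) * ((lam * (r * γ + w) : ℝ) : ℂ) ^ (-ξ) =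
      ((r / w : ℝ) : ℂ) ^ (s - 1) * ((lam * w : ℝ) : ℂ) ^ (-ξ) *
        (Gamma (1 - s) * Gamma (ξ + s - 1) / Gamma ξ) := by
  have hk : 0 < r / w := div_pos hr hw
  have hkc : ((r / w : ℝ) : ℂ) ≠ 0 := by exact_mod_cast hk.ne'
  have hbeta : betaIntegral (1 - s) (ξ + s - 1) =
      Gamma (1 - s) * Gamma (ξ + s - 1) / Gamma ξ := by
    rw [betaIntegral_eq_Gamma_mul_div _ _ (by simp; linarith) (by simp; linarith)]
    ring_nf
  have hscale := integral_comp_mul_left_Ioi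
    (fun y : ℝ => (y : ℂ) ^ ((1 - s) - 1) *
      ((1 + y : ℝ) : ℂ) ^ (-((1 - s) + (ξ + s - 1)))) 0 hk
  rw [mul_zero, integral_Ioi_cpow_mul_one_add_cpow, hbeta, real_smul] at hscale
  have hfactor : ∀ γ ∈ Ioi (0 : ℝ),
      (γ : ℂ) ^ (-s) * ((lam * (r * γ + w) : ℝ) : ℂ) ^ (-ξ) =
        ((r / w : ℝ) : ℂ) ^ s * ((lam * w : ℝ) : ℂ) ^ (-ξ) *
          (((r / w * γ : ℝ) : ℂ) ^ ((1 - s) - 1) *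
            ((1 + r / w * γ : ℝ) : ℂ) ^ (-((1 - s) + (ξ + s - 1)))) := by
    intro γ hγ
    have hγ : 0 < γ := hγ
    rw [show lam * (r * γ + w) = lam * w * (1 + r / w * γ) by field_simp; ring,
      show (1 - s) - 1 = -s by ring, show (1 - s) + (ξ + s - 1) = ξ by ring,
      ofReal_mul (lam * w), mul_cpow_ofReal_nonneg (by positivity) (by positivity),
      ofReal_mul (r / w), mul_cpow_ofReal_nonneg hk.le hγ.le, cpow_neg ((r / w : ℝ) : ℂ)]
    have : ((r / w : ℝ) : ℂ) ^ s ≠ 0 := by simp [cpow_eq_zero_iff, hr.ne', hw.ne']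
    field_simp
  rw [setIntegral_congr_fun measurableSet_Ioi hfactor, integral_const_mul, hscale,
    cpow_sub _ _ hkc, cpow_one, ofReal_inv]
  ring

/-- **Mellin transform of the shifted complementary CDF (eq. (34)).**
Let `f_B` be a Fox H-function density with data `(κ_B, λ_B, Θ_B, c_B)` whose CCDF
representation holds at level `σ' > 0`, `F̄_B(x) = ∫_x^∞ f_B`. For `R_s > 1`,
`W = R_s − 1` and `s` with `Re s < 1`, `σ' + Re s > 1`, if Fubini's theorem applies,
then `∫₀^∞ γ^{−s} F̄_B(R_s γ + W) dγ = (κ_B/λ_B) Γ(1−s) (R_s/W)^{s−1} ·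
(1/(2π)) ∫_ℝ [Γ(ξ+s−1)/(ξΓ(ξ))] Θ_B(1+ξ) (λ_B W)^{−ξ} dt`, `ξ = σ' + it`. -/
theorem mellin_shifted_ccdf (fB : ℝ → ℝ) (κB lamB cB σ' : ℝ) (DB : FoxData)
    (hfB : IsFoxDensity fB κB lamB DB cB) (hCCDF : HasCCDFRep fB κB lamB DB σ')
    (Rs W : ℝ) (hRs : 1 < Rs) (hW : W = Rs - 1)
    (s : ℂ) (hs1 : s.re < 1) (hs2 : 1 < σ' + s.re)
    (hFub : IntegrableOn
      (fun p : ℝ × ℝ => (p.1 : ℂ) ^ (-s) *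
        (DB.kernel (1 + ((σ' : ℂ) + (p.2 : ℂ) * Complex.I)) /
          ((σ' : ℂ) + (p.2 : ℂ) * Complex.I)) *
        ((lamB * (Rs * p.1 + W) : ℝ) : ℂ) ^ (-((σ' : ℂ) + (p.2 : ℂ) * Complex.I)))
      (Ioi (0 : ℝ) ×ˢ (univ : Set ℝ))) :
    ∫ γ in Ioi (0 : ℝ), (γ : ℂ) ^ (-s) * ((∫ u in Ioi (Rs * γ + W), fB u : ℝ) : ℂ) =
      ((κB / lamB : ℝ) : ℂ) * Complex.Gamma (1 - s) * ((Rs / W : ℝ) : ℂ) ^ (s - 1) *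
        (1 / (2 * (π : ℝ))) *
        ∫ t : ℝ, Complex.Gamma (((σ' : ℂ) + (t : ℂ) * Complex.I) + s - 1) /
            (((σ' : ℂ) + (t : ℂ) * Complex.I) *
              Complex.Gamma ((σ' : ℂ) + (t : ℂ) * Complex.I)) *
          DB.kernel (1 + ((σ' : ℂ) + (t : ℂ) * Complex.I)) *
          ((lamB * W : ℝ) : ℂ) ^ (-((σ' : ℂ) + (t : ℂ) * Complex.I)) := by
  obtain ⟨-, hlam, -⟩ := hfB
  have hR : 0 < Rs := by linarith
  have hW0 : 0 < W := by linarith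
  have hswap := integral_integral_swap (f := fun (γ t : ℝ) => (γ : ℂ) ^ (-s) *
      (DB.kernel (1 + ((σ' : ℂ) + (t : ℂ) * Complex.I)) /
        ((σ' : ℂ) + (t : ℂ) * Complex.I)) *
      ((lamB * (Rs * γ + W) : ℝ) : ℂ) ^ (-((σ' : ℂ) + (t : ℂ) * Complex.I)))
    (μ := volume.restrict (Ioi (0 : ℝ))) (ν := volume) (by
      rw [IntegrableOn, Measure.volume_eq_prod, ← Measure.prod_restrict,
        Measure.restrict_univ] at hFub
      exact hFub)
  have hleft : ∀ γ ∈ Ioi (0 : ℝ),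
      (γ : ℂ) ^ (-s) * ((∫ u in Ioi (Rs * γ + W), fB u : ℝ) : ℂ) =
        (κB : ℂ) / (2 * (π : ℝ) * lamB) * ∫ t : ℝ, (γ : ℂ) ^ (-s) *
          (DB.kernel (1 + ((σ' : ℂ) + (t : ℂ) * Complex.I)) /
            ((σ' : ℂ) + (t : ℂ) * Complex.I)) *
          ((lamB * (Rs * γ + W) : ℝ) : ℂ) ^ (-((σ' : ℂ) + (t : ℂ) * Complex.I)) := by
    intro γ hγ
    have hγ : 0 < γ := hγ
    rw [hCCDF.2 _ (by positivity)]
    simp_rw [mul_assoc ((γ : ℂ) ^ (-s))]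
    rw [integral_const_mul]
    ring
  have hright : ∀ t : ℝ, (∫ γ in Ioi (0 : ℝ), (γ : ℂ) ^ (-s) *
          (DB.kernel (1 + ((σ' : ℂ) + (t : ℂ) * Complex.I)) /
            ((σ' : ℂ) + (t : ℂ) * Complex.I)) *
          ((lamB * (Rs * γ + W) : ℝ) : ℂ) ^ (-((σ' : ℂ) + (t : ℂ) * Complex.I))) =
      Complex.Gamma (1 - s) * ((Rs / W : ℝ) : ℂ) ^ (s - 1) *
        (Complex.Gamma (((σ' : ℂ) + (t : ℂ) * Complex.I) + s - 1) /
            (((σ' : ℂ) + (t : ℂ) * Complex.I) *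
              Complex.Gamma ((σ' : ℂ) + (t : ℂ) * Complex.I)) *
          DB.kernel (1 + ((σ' : ℂ) + (t : ℂ) * Complex.I)) *
          ((lamB * W : ℝ) : ℂ) ^ (-((σ' : ℂ) + (t : ℂ) * Complex.I))) := by
    intro t
    simp_rw [mul_right_comm ((_ : ℂ) ^ (-s))]
    rw [integral_mul_const, integral_Ioi_cpow_mul_affine_cpow hlam hR hW0 hs1 (by simpa using hs2)]
    simp only [div_eq_mul_inv, mul_inv]
    ring
  rw [setIntegral_congr_fun measurableSet_Ioi hleft, integral_const_mul, hswap]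
  simp_rw [hright]
  rw [integral_const_mul]
  push_cast
  simp only [div_eq_mul_inv, mul_inv]
  ring
end
end

section
/- Lower bound of the secrecy outage probability (Proposition 1, eq. (15)): Let γ_B, γ_E be independent nonnegative random variables, where γ_B has a Fox H-function density with data (κ_B, λ_B, Θ_B, c_B) whose CCDF representation holds at some level σ' > 0, and γ_E has a Fox H-function density f_E with data (κ_E, λ_E, Θ_E, c_E) such that ∫₀^∞ x^{s−1} f_E(x) dx converges absolutely and equals κ_E λ_E^{−s} Θ_E(s) for all s with Re s = 1 − σ'. Let R_s ≥ 1. If the iterated integrals converge absolutely, then Pr(γ_B ≤ R_s γ_E) = 1 − (κ_B κ_E/(λ_B λ_E)) · (1/(2π)) ∫_ℝ [Θ_B(1+ξ)/ξ] Θ_E(1−ξ) (λ_B R_s/λ_E)^{−ξ} dt, where ξ = σ' + it. -/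
open MeasureTheory Complex Set Filter
open scoped Real

noncomputable section

/-- For independent `X, Y` with `X ≥ 0` and densities `f, g`, the probability of `r X < Y` is
the average of the tail of `g` at `r x` against `f`. -/
theorem measureReal_mul_lt_eq_integral {Ω : Type*} [MeasurableSpace Ω] {μ : Measure Ω}
    [IsProbabilityMeasure μ] {X Y : Ω → ℝ} {f g : ℝ → ℝ} (hX0 : ∀ ω, 0 ≤ X ω)
    (hIndep : ProbabilityTheory.IndepFun Y X μ)
    (hf : Measurable f) (hf0 : ∀ x, 0 ≤ f x) (hX : HasDensity μ X f)
    (hg : Measurable g) (hg0 : ∀ x, 0 ≤ g x) (hY : HasDensity μ Y g) (r : ℝ) :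
    μ.real {ω | r * X ω < Y ω} = ∫ x in Ioi (0 : ℝ), f x * ∫ u in Ioi (r * x), g u := by
  obtain ⟨hXm, hXd⟩ := hX
  obtain ⟨hYm, hYd⟩ := hY
  have : IsProbabilityMeasure (μ.map X) := Measure.isProbabilityMeasure_map hXm.aemeasurable
  have : IsProbabilityMeasure (μ.map Y) := Measure.isProbabilityMeasure_map hYm.aemeasurable
  let s : Set (ℝ × ℝ) := {p | r * p.1 < p.2}
  have hs : MeasurableSet s := measurableSet_lt (by fun_prop) (by fun_prop)
  have hpos : ∀ᵐ x ∂μ.map X, x ∈ Ioi (0 : ℝ) := by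
    have hnonneg : ∀ᵐ x ∂μ.map X, 0 ≤ x :=
      (ae_map_iff hXm.aemeasurable measurableSet_Ici).2 (.of_forall hX0)
    have hne : ∀ᵐ x ∂μ.map X, x ≠ 0 := by
      rw [hXd]
      exact (withDensity_absolutelyContinuous _ _).ae_le (Measure.ae_ne volume 0)
    filter_upwards [hnonneg, hne] with x h₁ h₂ using lt_of_le_of_ne h₁ h₂.symm
  have htail (x : ℝ) : (μ.map Y).real (Prod.mk x ⁻¹' s) = ∫ u in Ioi (r * x), g u := by
    change (μ.map Y).real (Ioi (r * x)) = _
    rw [hYd, measureReal_def, withDensity_apply _ measurableSet_Ioi,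
      integral_eq_lintegral_of_nonneg_ae (.of_forall hg0) hg.aestronglyMeasurable]
  have hprod : μ.real {ω | r * X ω < Y ω} = ((μ.map X).prod (μ.map Y)).real s := by
    rw [← (ProbabilityTheory.indepFun_iff_map_prod_eq_prod_map_map hXm.aemeasurable
      hYm.aemeasurable).1 hIndep.symm, map_measureReal_apply (hXm.prodMk hYm) hs]
    rfl
  calc
    _ = ∫ x, (μ.map Y).real (Prod.mk x ⁻¹' s) ∂μ.map X := by
      rw [hprod, measureReal_def, Measure.prod_apply hs]
      exact (integral_toReal (measurable_measure_prodMk_left hs).aemeasurable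
        (.of_forall fun _ => measure_lt_top _ _)).symm
    _ = ∫ x in Ioi (0 : ℝ), (∫ u in Ioi (r * x), g u) ∂μ.map X := by
      rw [Measure.restrict_eq_self_of_ae_mem hpos]
      simp_rw [htail]
    _ = _ := by
      rw [hXd, setIntegral_withDensity_eq_setIntegral_toReal_smul
        hf.ennreal_ofReal (.of_forall fun _ => ENNReal.ofReal_lt_top) _ measurableSet_Ioi]
      simp_rw [ENNReal.toReal_ofReal (hf0 _), smul_eq_mul]

/-- The Mellin transform of a density, rescaled to integrate `(a x)^{-ξ}` against it. -/
theorem integral_cpow_neg_mul_of_mellin {f : ℝ → ℝ} {κ lam a : ℝ} (hlam : 0 < lam) (ha : 0 < a)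
    (K ξ : ℂ)
    (hM : ∫ x in Ioi (0 : ℝ), (x : ℂ) ^ (1 - ξ - 1) * (f x : ℂ) =
      (κ : ℂ) * (lam : ℂ) ^ (-(1 - ξ)) * K) :
    ∫ x in Ioi (0 : ℝ), ((a * x : ℝ) : ℂ) ^ (-ξ) * (f x : ℂ) =
      (κ / lam : ℝ) * (K * ((a / lam : ℝ) : ℂ) ^ (-ξ)) := by
  have hlam' : (lam : ℂ) ≠ 0 := ofReal_ne_zero.2 hlam.ne'
  have hscale : ∫ x in Ioi (0 : ℝ), ((a * x : ℝ) : ℂ) ^ (-ξ) * (f x : ℂ) =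
      (a : ℂ) ^ (-ξ) * ∫ x in Ioi (0 : ℝ), (x : ℂ) ^ (1 - ξ - 1) * (f x : ℂ) := by
    rw [← integral_const_mul]
    refine setIntegral_congr_fun measurableSet_Ioi fun x hx => ?_
    have : 1 - ξ - 1 = -ξ := by ring
    simp only [this]
    rw [ofReal_mul, mul_cpow_ofReal_nonneg ha.le (le_of_lt hx), mul_assoc]
  have hdiv : ((a / lam : ℝ) : ℂ) ^ (-ξ) = (a : ℂ) ^ (-ξ) * (lam : ℂ) ^ ξ := by
    rw [div_eq_mul_inv, ofReal_mul, mul_cpow_ofReal_nonneg ha.le (inv_nonneg.2 hlam.le),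
      ofReal_inv, inv_cpow _ _ (by rw [arg_ofReal_of_nonneg hlam.le]; exact Real.pi_pos.ne),
      cpow_neg, cpow_neg, inv_inv]
  have hpow : (lam : ℂ) ^ (-(1 - ξ)) = (lam : ℂ) ^ ξ / lam := by
    rw [show -(1 - ξ) = ξ - 1 by ring, cpow_sub _ _ hlam', cpow_one]
  rw [hscale, hM, hdiv, hpow]
  push_cast
  ring

/-- **Lower bound of the secrecy outage probability (Proposition 1, eq. (15)).**
For independent `γ_B, γ_E` with Fox H-function densities, the CCDF representation of
`γ_B`'s density holding at level `σ' > 0`, the Mellin transform of `f_E` being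
`κ_E λ_E^{−s} Θ_E(s)` on the line `Re s = 1 − σ'`, and `R_s ≥ 1`, if Fubini's theorem
applies then `Pr(γ_B ≤ R_s γ_E) = 1 − (κ_B κ_E/(λ_B λ_E)) (1/(2π))
∫_ℝ [Θ_B(1+ξ)/ξ] Θ_E(1−ξ) (λ_B R_s/λ_E)^{−ξ} dt`, `ξ = σ' + it`. -/
theorem sop_lower_bound_foxH {Ω : Type*} [MeasurableSpace Ω] (μ : Measure Ω)
    [IsProbabilityMeasure μ] (γB γE : Ω → ℝ)
    (hB0 : ∀ ω, 0 ≤ γB ω) (hE0 : ∀ ω, 0 ≤ γE ω)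
    (hIndep : ProbabilityTheory.IndepFun γB γE μ)
    (fB fE : ℝ → ℝ) (κB lamB cB κE lamE cE σ' : ℝ) (DB DE : FoxData)
    (hfB : IsFoxDensity fB κB lamB DB cB) (hBf : HasDensity μ γB fB)
    (hCCDF : HasCCDFRep fB κB lamB DB σ')
    (hfE : IsFoxDensity fE κE lamE DE cE) (hEf : HasDensity μ γE fE)
    (hMellinE : ∀ z : ℂ, z.re = 1 - σ' →
      IntegrableOn (fun x : ℝ => (x : ℂ) ^ (z - 1) * (fE x : ℂ)) (Ioi 0) ∧
        ∫ x in Ioi (0 : ℝ), (x : ℂ) ^ (z - 1) * (fE x : ℂ) =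
          (κE : ℂ) * (lamE : ℂ) ^ (-z) * DE.kernel z)
    (Rs : ℝ) (hRs : 1 ≤ Rs)
    (hFub : IntegrableOn
      (fun p : ℝ × ℝ =>
        (DB.kernel (1 + ((σ' : ℂ) + (p.2 : ℂ) * Complex.I)) /
            ((σ' : ℂ) + (p.2 : ℂ) * Complex.I)) *
          ((lamB * Rs * p.1 : ℝ) : ℂ) ^ (-((σ' : ℂ) + (p.2 : ℂ) * Complex.I)) *
          (fE p.1 : ℂ))
      (Ioi (0 : ℝ) ×ˢ (univ : Set ℝ))) :
    ((μ {ω | γB ω ≤ Rs * γE ω}).toReal : ℂ) =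
      1 - ((κB * κE / (lamB * lamE) : ℝ) : ℂ) * (1 / (2 * (π : ℝ))) *
        ∫ t : ℝ,
          (DB.kernel (1 + ((σ' : ℂ) + (t : ℂ) * Complex.I)) /
              ((σ' : ℂ) + (t : ℂ) * Complex.I)) *
            DE.kernel (1 - ((σ' : ℂ) + (t : ℂ) * Complex.I)) *
            ((lamB * Rs / lamE : ℝ) : ℂ) ^ (-((σ' : ℂ) + (t : ℂ) * Complex.I)) := by
  obtain ⟨-, hlamB, hfBm, -, -, -, hfB0, -⟩ := hfB
  obtain ⟨-, hlamE, hfEm, -, -, -, hfE0, -⟩ := hfE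
  have hRs0 : 0 < Rs := one_pos.trans_le hRs
  have hcompl : μ.real {ω | γB ω ≤ Rs * γE ω} = 1 - μ.real {ω | Rs * γE ω < γB ω} := by
    rw [← probReal_compl_eq_one_sub (measurableSet_lt (hEf.1.const_mul Rs) hBf.1)]
    congr 1
    ext ω
    simp
  rw [← measureReal_def, hcompl, ofReal_sub, ofReal_one,
    measureReal_mul_lt_eq_integral hE0 hIndep hfEm hfE0 hEf hfBm hfB0 hBf, ← integral_complex_ofReal]
  congr 1
  let ξ : ℝ → ℂ := fun t => (σ' : ℂ) + (t : ℂ) * Complex.I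
  let F : ℝ → ℝ → ℂ := fun x t => DB.kernel (1 + ξ t) / ξ t *
    ((lamB * Rs * x : ℝ) : ℂ) ^ (-ξ t) * (fE x : ℂ)
  have hF : Integrable (Function.uncurry F) ((volume.restrict (Ioi 0)).prod volume) := by
    rwa [IntegrableOn, Measure.volume_eq_prod, ← Measure.prod_restrict,
      Measure.restrict_univ] at hFub
  calc
    _ = ∫ x in Ioi (0 : ℝ), (κB : ℂ) / (2 * (π : ℝ) * lamB) * ∫ t, F x t := by
      refine setIntegral_congr_fun measurableSet_Ioi fun x hx => ?_
      simp only [F]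
      rw [integral_mul_const, ofReal_mul, hCCDF.2 _ (mul_pos hRs0 hx), ← mul_assoc lamB]
      ring
    _ = (κB : ℂ) / (2 * (π : ℝ) * lamB) * ∫ t, ∫ x in Ioi (0 : ℝ), F x t := by
      rw [integral_const_mul, integral_integral_swap hF]
    _ = (κB : ℂ) / (2 * (π : ℝ) * lamB) * ∫ t, (κE / lamE : ℝ) * (DB.kernel (1 + ξ t) / ξ t *
        DE.kernel (1 - ξ t) * ((lamB * Rs / lamE : ℝ) : ℂ) ^ (-ξ t)) := by
      congr 1
      refine integral_congr_ae (.of_forall fun t => ?_)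
      simp only [F, mul_assoc (DB.kernel _ / _)]
      rw [integral_const_mul, integral_cpow_neg_mul_of_mellin hlamE (mul_pos hlamB hRs0) _ _
        (hMellinE (1 - ξ t) (by simp [ξ])).2]
      ring
    _ = _ := by
      rw [integral_const_mul, ← mul_assoc]
      congr 1
      push_cast
      ring
end
end

section
/- Probability of non-zero secrecy capacity over Fox H-function wiretap fading channels (Theorem 3, eq. (16)): Let γ_B, γ_E be independent nonnegative random variables with Fox H-function densities f_B, with data (κ_B, λ_B, Θ_B, c_B), and f_E, with data (κ_E, λ_E, Θ_E, c_E) where 0 < c_E < 1. Assume ∫₀^∞ x^{s−1} f_B(x) dx converges absolutely and equals κ_B λ_B^{−s} Θ_B(s) for all s with Re s = 2 − c_E. If the iterated integrals converge absolutely, then Pr(γ_B > γ_E) = (κ_B κ_E/λ_E²) · (1/(2π)) ∫_ℝ [Θ_B(s) Θ_E(2−s)/(s−1)] (λ_B/λ_E)^{−s} dt, where s = (2 − c_E) + it. -/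
open MeasureTheory Complex Set Filter
open scoped Real

noncomputable section

/-- Integrating an inverse Mellin transform over `(0, x)` term by term. -/
theorem setIntegral_Ioo_inverseMellin {Θ : ℝ → ℂ} (hΘ : Integrable Θ) {lam c x : ℝ}
    (hlam : 0 < lam) (hc : c < 1) (hx : 0 < x) :
    ∫ y in Ioo 0 x, ∫ t : ℝ, Θ t * ((lam * y : ℝ) : ℂ) ^ (-((c : ℂ) + (t : ℂ) * I)) =
      ∫ t : ℝ, Θ t * (lam : ℂ) ^ (-((c : ℂ) + (t : ℂ) * I)) *
        (x : ℂ) ^ (1 - ((c : ℂ) + (t : ℂ) * I)) / (1 - ((c : ℂ) + (t : ℂ) * I)) := by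
  have hrpow : IntegrableOn (fun y : ℝ => y ^ (-c)) (Ioo 0 x) :=
    (intervalIntegral.integrableOn_Ioo_rpow_iff hx).2 (by linarith)
  have hbound : Integrable
      (fun p : ℝ × ℝ => (lam ^ (-c) * p.1 ^ (-c)) * ‖Θ p.2‖)
      ((volume.restrict (Ioo 0 x)).prod volume) :=
    (hrpow.const_mul (lam ^ (-c))).mul_prod hΘ.norm
  have hpos : ∀ᵐ p : ℝ × ℝ ∂((volume.restrict (Ioo 0 x)).prod volume), 0 < p.1 := by
    have h : ∀ᵐ y : ℝ ∂(volume.restrict (Ioo 0 x)), 0 < y :=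
      (ae_restrict_mem measurableSet_Ioo).mono fun y hy => hy.1
    exact Measure.quasiMeasurePreserving_fst.ae h
  rw [integral_integral_swap]
  · refine integral_congr_ae (ae_of_all _ fun t => ?_)
    set s : ℂ := (c : ℂ) + (t : ℂ) * I with hs
    have hsre : s.re = c := by simp [hs]
    have hsplit : ∀ y ∈ Ioo 0 x, Θ t * ((lam * y : ℝ) : ℂ) ^ (-s) =
        (Θ t * (lam : ℂ) ^ (-s)) * (y : ℂ) ^ (-s) := fun y hy => by
      rw [ofReal_mul, mul_cpow_ofReal_nonneg hlam.le hy.1.le, mul_assoc]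
    dsimp only
    rw [setIntegral_congr_fun measurableSet_Ioo hsplit, integral_const_mul,
      ← integral_Ioc_eq_integral_Ioo, ← intervalIntegral.integral_of_le hx.le,
      integral_cpow (Or.inl (by rw [neg_re, hsre]; linarith)), ofReal_zero,
      zero_cpow (fun h => by
        have := congrArg re h
        simp [hsre] at this
        linarith), sub_zero, mul_div_assoc, neg_add_eq_sub]
  · refine hbound.mono' ?_ ?_
    · exact hΘ.aestronglyMeasurable.comp_snd.mul
        (by fun_prop : Measurable fun p : ℝ × ℝ =>
          ((lam * p.1 : ℝ) : ℂ) ^ (-((c : ℂ) + (p.2 : ℂ) * I))).aestronglyMeasurable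
    · filter_upwards [hpos] with p hp
      rw [Function.uncurry_apply_pair, norm_mul, norm_cpow_eq_rpow_re_of_pos (mul_pos hlam hp),
        mul_comm]
      simp [Real.mul_rpow hlam.le hp.le]

/-- The distribution function of a Fox H-function density whose contour lies left of `1`. -/
theorem IsFoxDensity.setIntegral_Ioo {f : ℝ → ℝ} {κ lam c x : ℝ} {D : FoxData}
    (hf : IsFoxDensity f κ lam D c) (hc : c < 1) (hx : 0 < x) :
    ((∫ y in Ioo 0 x, f y : ℝ) : ℂ) = (κ : ℂ) / (2 * (π : ℝ)) *
      ∫ t : ℝ, D.kernel ((c : ℂ) + (t : ℂ) * I) * (lam : ℂ) ^ (-((c : ℂ) + (t : ℂ) * I)) *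
        (x : ℂ) ^ (1 - ((c : ℂ) + (t : ℂ) * I)) / (1 - ((c : ℂ) + (t : ℂ) * I)) := by
  obtain ⟨-, hlam, -, hint, -, hrep, -, -⟩ := hf
  rw [← integral_complex_ofReal,
    setIntegral_congr_fun measurableSet_Ioo (fun y hy => hrep y hy.1),
    integral_const_mul, setIntegral_Ioo_inverseMellin hint hlam hc hx]

/-- For a nonnegative random variable with density `f ≥ 0`, the law of `(-∞, x)` is the integral
of `f` over `(0, x)`. -/
theorem HasDensity.measureReal_Iio {Ω : Type*} [MeasurableSpace Ω] {μ : Measure Ω} {X : Ω → ℝ}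
    {f : ℝ → ℝ} (h : HasDensity μ X f) (hX : ∀ ω, 0 ≤ X ω) (hfm : Measurable f)
    (hf : ∀ x, 0 ≤ f x) (x : ℝ) :
    (μ.map X).real (Iio x) = ∫ y in Ioo 0 x, f y := by
  have hIio : μ.map X (Iio 0) = 0 := by
    rw [Measure.map_apply h.1 measurableSet_Iio]
    convert measure_empty (μ := μ)
    ext ω
    simpa using hX ω
  have hsing : μ.map X {0} = 0 := by
    rw [h.2]
    exact withDensity_absolutelyContinuous _ _ (by simp)
  have hIic : μ.map X (Iic 0) = 0 := by
    rw [← Iio_union_right]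
    exact measure_union_null hIio hsing
  have heq : μ.map X (Iio x) = μ.map X (Ioo 0 x) := by
    refine le_antisymm ?_ (measure_mono Ioo_subset_Iio_self)
    calc μ.map X (Iio x) ≤ μ.map X (Iic 0 ∪ Ioo 0 x) := measure_mono fun y hy => by
          rcases le_or_gt y 0 with h0 | h0
          · exact Or.inl h0
          · exact Or.inr ⟨h0, hy⟩
      _ ≤ μ.map X (Iic 0) + μ.map X (Ioo 0 x) := measure_union_le _ _
      _ = μ.map X (Ioo 0 x) := by rw [hIic, zero_add]
  rw [measureReal_def, heq, h.2, withDensity_apply _ measurableSet_Ioo,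
    integral_eq_lintegral_of_nonneg_ae (ae_of_all _ hf) hfm.aestronglyMeasurable]

/-- For independent nonnegative random variables with densities, the probability that one exceeds
the other is the average of the distribution function of the latter against the density of the
former. -/
theorem HasDensity.measureReal_lt {Ω : Type*} [MeasurableSpace Ω] {μ : Measure Ω}
    [IsProbabilityMeasure μ] {X Y : Ω → ℝ} {f g : ℝ → ℝ} (hXf : HasDensity μ X f)
    (hYg : HasDensity μ Y g) (hXY : ProbabilityTheory.IndepFun X Y μ) (hY : ∀ ω, 0 ≤ Y ω)
    (hfm : Measurable f) (hf : ∀ x, 0 ≤ f x) (hgm : Measurable g) (hg : ∀ x, 0 ≤ g x) :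
    (μ {ω | Y ω < X ω}).toReal = ∫ x in Ioi (0 : ℝ), f x * ∫ y in Ioo 0 x, g y := by
  have := Measure.isProbabilityMeasure_map (μ := μ) hXf.1.aemeasurable
  have := Measure.isProbabilityMeasure_map (μ := μ) hYg.1.aemeasurable
  have hS : MeasurableSet {p : ℝ × ℝ | p.2 < p.1} := measurableSet_lt measurable_snd measurable_fst
  have hcdf : Measurable fun x => μ.map Y (Iio x) :=
    Monotone.measurable fun a b hab => measure_mono (Iio_subset_Iio hab)
  have hprod : μ {ω | Y ω < X ω} = ∫⁻ x, μ.map Y (Iio x) ∂(μ.map X) := by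
    have hpre : {ω | Y ω < X ω} = (fun ω => (X ω, Y ω)) ⁻¹' {p : ℝ × ℝ | p.2 < p.1} := rfl
    rw [hpre, ← Measure.map_apply (hXf.1.prodMk hYg.1) hS,
      (ProbabilityTheory.indepFun_iff_map_prod_eq_prod_map_map hXf.1.aemeasurable
        hYg.1.aemeasurable).1 hXY, Measure.prod_apply hS]
    rfl
  have hreal : (μ {ω | Y ω < X ω}).toReal = ∫ x, (μ.map Y).real (Iio x) ∂(μ.map X) := by
    rw [hprod, ← integral_toReal hcdf.aemeasurable (ae_of_all _ fun x => measure_lt_top _ _)]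
    rfl
  rw [hreal, hXf.2, integral_withDensity_eq_integral_toReal_smul hfm.ennreal_ofReal
      (ae_of_all _ fun x => ENNReal.ofReal_lt_top),
    setIntegral_eq_integral_of_forall_compl_eq_zero fun x hx => by
      rw [Ioo_eq_empty (by simpa using hx)]; simp]
  refine integral_congr_ae (ae_of_all _ fun x => ?_)
  simp only [hYg.measureReal_Iio hY hgm hg, ENNReal.toReal_ofReal (hf x), smul_eq_mul]

/-- **Probability of non-zero secrecy capacity over Fox H-function wiretap fading
channels (Theorem 3, eq. (16)).**
For independent `γ_B, γ_E` with Fox H-function densities, `0 < c_E < 1`, the Mellin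
transform of `f_B` being `κ_B λ_B^{−s} Θ_B(s)` on the line `Re s = 2 − c_E`, and
assuming Fubini's theorem applies,
`Pr(γ_B > γ_E) = (κ_B κ_E/λ_E²)(1/(2π)) ∫_ℝ [Θ_B(s)Θ_E(2−s)/(s−1)] (λ_B/λ_E)^{−s} dt`,
`s = (2 − c_E) + it`. -/
theorem pnz_foxH {Ω : Type*} [MeasurableSpace Ω] (μ : Measure Ω)
    [IsProbabilityMeasure μ] (γB γE : Ω → ℝ)
    (hB0 : ∀ ω, 0 ≤ γB ω) (hE0 : ∀ ω, 0 ≤ γE ω)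
    (hIndep : ProbabilityTheory.IndepFun γB γE μ)
    (fB fE : ℝ → ℝ) (κB lamB cB κE lamE cE : ℝ) (DB DE : FoxData)
    (hfB : IsFoxDensity fB κB lamB DB cB) (hBf : HasDensity μ γB fB)
    (hfE : IsFoxDensity fE κE lamE DE cE) (hEf : HasDensity μ γE fE)
    (hcE0 : 0 < cE) (hcE1 : cE < 1)
    (hMellinB : ∀ z : ℂ, z.re = 2 - cE →
      IntegrableOn (fun x : ℝ => (x : ℂ) ^ (z - 1) * (fB x : ℂ)) (Ioi 0) ∧
        ∫ x in Ioi (0 : ℝ), (x : ℂ) ^ (z - 1) * (fB x : ℂ) =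
          (κB : ℂ) * (lamB : ℂ) ^ (-z) * DB.kernel z)
    (hFub : IntegrableOn
      (fun p : ℝ × ℝ =>
        (fB p.1 : ℂ) * DE.kernel ((cE : ℂ) + (p.2 : ℂ) * Complex.I) *
          (lamE : ℂ) ^ (-((cE : ℂ) + (p.2 : ℂ) * Complex.I)) *
          (p.1 : ℂ) ^ (1 - ((cE : ℂ) + (p.2 : ℂ) * Complex.I)) /
          (1 - ((cE : ℂ) + (p.2 : ℂ) * Complex.I)))
      (Ioi (0 : ℝ) ×ˢ (univ : Set ℝ))) :
    ((μ {ω | γE ω < γB ω}).toReal : ℂ) =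
      ((κB * κE / lamE ^ 2 : ℝ) : ℂ) * (1 / (2 * (π : ℝ))) *
        ∫ t : ℝ,
          DB.kernel (((2 - cE : ℝ) : ℂ) + (t : ℂ) * Complex.I) *
            DE.kernel (2 - (((2 - cE : ℝ) : ℂ) + (t : ℂ) * Complex.I)) /
            ((((2 - cE : ℝ) : ℂ) + (t : ℂ) * Complex.I) - 1) *
            ((lamB / lamE : ℝ) : ℂ) ^ (-(((2 - cE : ℝ) : ℂ) + (t : ℂ) * Complex.I)) := by
  obtain ⟨-, hlamB, hfBm, -, -, -, hfB0, -⟩ := id hfB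
  obtain ⟨-, hlamE, hfEm, -, -, -, hfE0, -⟩ := id hfE
  have hlamE' : (lamE : ℂ) ≠ 0 := ofReal_ne_zero.2 hlamE.ne'
  have hswap := integral_integral_swap
    (μ := volume.restrict (Ioi (0 : ℝ))) (ν := (volume : Measure ℝ))
    (f := fun x t : ℝ => (fB x : ℂ) * DE.kernel ((cE : ℂ) + (t : ℂ) * I) *
      (lamE : ℂ) ^ (-((cE : ℂ) + (t : ℂ) * I)) *
      (x : ℂ) ^ (1 - ((cE : ℂ) + (t : ℂ) * I)) / (1 - ((cE : ℂ) + (t : ℂ) * I)))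
    (by
      rw [IntegrableOn, Measure.volume_eq_prod, ← Measure.prod_restrict,
        Measure.restrict_univ] at hFub
      exact hFub)
  have hinner : ∀ t : ℝ, ∫ x in Ioi (0 : ℝ), (fB x : ℂ) * DE.kernel ((cE : ℂ) + (t : ℂ) * I) *
      (lamE : ℂ) ^ (-((cE : ℂ) + (t : ℂ) * I)) *
      (x : ℂ) ^ (1 - ((cE : ℂ) + (t : ℂ) * I)) / (1 - ((cE : ℂ) + (t : ℂ) * I)) =
      DE.kernel ((cE : ℂ) + (t : ℂ) * I) * (lamE : ℂ) ^ (-((cE : ℂ) + (t : ℂ) * I)) /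
        (1 - ((cE : ℂ) + (t : ℂ) * I)) *
        ((κB : ℂ) * (lamB : ℂ) ^ (-(2 - ((cE : ℂ) + (t : ℂ) * I))) *
          DB.kernel (2 - ((cE : ℂ) + (t : ℂ) * I))) := fun t => by
    rw [← (hMellinB (2 - ((cE : ℂ) + (t : ℂ) * I)) (by simp)).2, ← integral_const_mul]
    refine integral_congr_ae (ae_of_all _ fun x => ?_)
    dsimp only
    rw [show (2 - ((cE : ℂ) + (t : ℂ) * I)) - 1 = 1 - ((cE : ℂ) + (t : ℂ) * I) by ring]
    ring
  have hcdf : ∀ x ∈ Ioi (0 : ℝ), ((fB x * ∫ y in Ioo 0 x, fE y : ℝ) : ℂ) =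
      (κE : ℂ) / (2 * (π : ℝ)) * ∫ t : ℝ, (fB x : ℂ) * DE.kernel ((cE : ℂ) + (t : ℂ) * I) *
      (lamE : ℂ) ^ (-((cE : ℂ) + (t : ℂ) * I)) *
      (x : ℂ) ^ (1 - ((cE : ℂ) + (t : ℂ) * I)) / (1 - ((cE : ℂ) + (t : ℂ) * I)) := fun x hx => by
    rw [ofReal_mul, hfE.setIntegral_Ioo hcE1 hx, mul_left_comm, ← integral_const_mul]
    simp only [mul_assoc, mul_div_assoc]
  rw [hBf.measureReal_lt hEf hIndep hE0 hfBm hfB0 hfEm hfE0, ← integral_complex_ofReal,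
    setIntegral_congr_fun measurableSet_Ioi hcdf, integral_const_mul, hswap,
    ← integral_neg_eq_self, ← integral_const_mul, ← integral_const_mul]
  refine integral_congr_ae (ae_of_all _ fun t => ?_)
  dsimp only
  rw [hinner]
  set z : ℂ := ((2 - cE : ℝ) : ℂ) + (t : ℂ) * I with hz
  have hs : (cE : ℂ) + ((-t : ℝ) : ℂ) * I = 2 - z := by
    rw [hz]; push_cast; ring
  have hdiv : ((lamB / lamE : ℝ) : ℂ) ^ (-z) = (lamB : ℂ) ^ (-z) * (lamE : ℂ) ^ z := by
    rw [div_eq_mul_inv, ofReal_mul, mul_cpow_ofReal_nonneg hlamB.le (inv_pos.2 hlamE).le,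
      ofReal_inv, inv_cpow _ _ (by rw [arg_ofReal_of_nonneg hlamE.le]; exact Real.pi_pos.ne),
      cpow_neg (lamE : ℂ), inv_inv]
  have hpow : (lamE : ℂ) ^ (-(2 - z)) = (lamE : ℂ) ^ z / (lamE : ℂ) ^ 2 := by
    rw [neg_sub, cpow_sub _ _ hlamE', cpow_ofNat]
  rw [hs, hdiv, hpow, sub_sub_cancel, show 1 - (2 - z) = z - 1 by ring]
  push_cast
  ring
end
end

section
/- First term of the average secrecy capacity (Theorem 4, eq. (21a)): Let γ_B, γ_E be independent nonnegative random variables with Fox H-function densities f_B, with data (κ_B, λ_B, Θ_B, c_B), and f_E, with data (κ_E, λ_E, Θ_E, c_E) where 0 < c_E < 1, and let F_E be the CDF of γ_E. Let c ∈ (−1, 0) and assume ∫₀^∞ x^{s−1} f_B(x) dx converges absolutely and equals κ_B λ_B^{−s} Θ_B(s) for all s with Re s = 2 − c_E − c. If all iterated integrals converge absolutely (so Fubini's theorem applies), then ∫₀^∞ ln(1+x) f_B(x) F_E(x) dx = (κ_B κ_E/λ_B²) · (1/(2π))² ∫_ℝ ∫_ℝ Θ_B(2−ξ−z) Θ_E(ξ)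 [π/(z sin(πz))] [1/(1−ξ)] (λ_E/λ_B)^{−ξ} λ_B^{z} dt' dt, where ξ = c_E + it and z = c + it'. -/
open MeasureTheory Complex Set Filter
open scoped Real

noncomputable section

/-- Euler's integral of the second form: the Mellin transform of `1 / (1 + x)`. -/
theorem hasMellin_inv_one_add {s : ℂ} (h0 : 0 < s.re) (h1 : s.re < 1) :
    HasMellin (fun x : ℝ => (1 + (x : ℂ))⁻¹) s (π / Complex.sin (π * s)) := by
  have himage : (fun u : ℝ => u / (1 - u)) '' Ioo 0 1 = Ioi 0 := by
    ext x
    constructor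
    · rintro ⟨u, ⟨hu0, hu1⟩, rfl⟩
      exact div_pos hu0 (by linarith)
    · intro (hx : 0 < x)
      refine ⟨x / (1 + x), ⟨by positivity, by rw [div_lt_one] <;> linarith⟩, ?_⟩
      simp only
      field_simp
      ring
  have hderiv : ∀ u ∈ Ioo (0 : ℝ) 1,
      HasDerivWithinAt (fun u : ℝ => u / (1 - u)) (1 / (1 - u) ^ 2) (Ioo 0 1) u := by
    intro u hu
    have hne : 1 - u ≠ 0 := by linarith [hu.2]
    have h := (hasDerivAt_id u).div ((hasDerivAt_id u).const_sub 1) hne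
    convert! h.hasDerivWithinAt using 1
    simp
  have hinj : InjOn (fun u : ℝ => u / (1 - u)) (Ioo 0 1) := by
    intro u hu v hv h
    have hu' : 1 - u ≠ 0 := by linarith [hu.2]
    have hv' : 1 - v ≠ 0 := by linarith [hv.2]
    simp only at h
    rw [div_eq_div_iff hu' hv'] at h
    linarith
  have hcongr : EqOn (fun u : ℝ => |1 / (1 - u) ^ 2| •
      ((((u / (1 - u) : ℝ) : ℂ)) ^ (s - 1) • (1 + ((u / (1 - u) : ℝ) : ℂ))⁻¹))
      (fun u : ℝ => (u : ℂ) ^ (s - 1) * (1 - (u : ℂ)) ^ ((1 - s) - 1)) (Ioo 0 1) := by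
    intro u hu
    have hpos : 0 < 1 - u := by linarith [hu.2]
    have hne : (1 - (u : ℂ)) ≠ 0 := by exact_mod_cast hpos.ne'
    have hdiv : (((u / (1 - u) : ℝ) : ℂ)) ^ (s - 1) =
        (u : ℂ) ^ (s - 1) * (1 - (u : ℂ)) ^ (1 - s) := by
      rw [div_eq_mul_inv, ofReal_mul, mul_cpow_ofReal_nonneg hu.1.le (by positivity), ofReal_inv,
        ← ofReal_one, ← ofReal_sub, Complex.inv_cpow, ← cpow_neg]
      · simp
      · rw [arg_ofReal_of_nonneg hpos.le]
        exact Real.pi_pos.ne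
    have hadd : (1 + ((u / (1 - u) : ℝ) : ℂ))⁻¹ = 1 - (u : ℂ) := by
      push_cast
      field_simp
      ring
    simp only
    rw [hdiv, hadd, abs_of_pos (by positivity), cpow_sub (1 - s) 1 hne, cpow_one]
    simp only [real_smul, smul_eq_mul]
    push_cast
    field_simp
  have hs' : 0 < (1 - s).re := by simpa using h1
  constructor
  · rw [MellinConvergent, ← himage,
      integrableOn_image_iff_integrableOn_abs_deriv_smul measurableSet_Ioo hderiv hinj,
      integrableOn_congr_fun hcongr measurableSet_Ioo]
    have h := betaIntegral_convergent h0 hs'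
    rw [intervalIntegrable_iff_integrableOn_Ioo_of_le zero_le_one] at h
    exact h
  · rw [mellin, ← himage,
      integral_image_eq_integral_abs_deriv_smul measurableSet_Ioo hderiv hinj,
      setIntegral_congr_fun measurableSet_Ioo hcongr, ← integral_Ioc_eq_integral_Ioo,
      ← intervalIntegral.integral_of_le zero_le_one, ← Complex.Gamma_mul_Gamma_one_sub,
      Complex.Gamma_mul_Gamma_eq_betaIntegral h0 hs']
    simp [betaIntegral]

theorem norm_log_one_add_le {x ε : ℝ} (hx : 0 ≤ x) (h0 : 0 < ε) (h1 : ε ≤ 1) :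
    ‖((Real.log (1 + x) : ℝ) : ℂ)‖ ≤ ε⁻¹ * x ^ ε := by
  rw [norm_real, Real.norm_of_nonneg (Real.log_nonneg (by linarith)), mul_comm, ← div_eq_mul_inv]
  exact log_one_add_le_rpow_div hx h0 h1

theorem hasMellin_log_one_add {s : ℂ} (h1 : -1 < s.re) (h0 : s.re < 0) :
    HasMellin (fun x : ℝ => ((Real.log (1 + x) : ℝ) : ℂ)) s (π / (s * Complex.sin (π * s))) := by
  have hs : s ≠ 0 := by
    rintro rfl
    simp at h0
  have hcont : ContinuousOn (fun x : ℝ => ((Real.log (1 + x) : ℝ) : ℂ)) (Ioi 0) := by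
    refine continuous_ofReal.comp_continuousOn (ContinuousOn.log (by fun_prop) ?_)
    intro x (hx : 0 < x)
    positivity
  have hε0 : 0 < -s.re / 2 := by linarith
  have hε1 : -s.re / 2 ≤ 1 := by linarith
  have hconv : MellinConvergent (fun x : ℝ => ((Real.log (1 + x) : ℝ) : ℂ)) s := by
    refine mellinConvergent_of_isBigO_rpow (a := -(-s.re / 2)) (b := -1)
      (hcont.locallyIntegrableOn measurableSet_Ioi) ?_ (by linarith) ?_ h1
    · refine Asymptotics.IsBigO.of_bound (-s.re / 2)⁻¹ ?_
      filter_upwards [eventually_gt_atTop 0] with x hx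
      rw [neg_neg, Real.norm_of_nonneg (by positivity : 0 ≤ x ^ (-s.re / 2))]
      exact norm_log_one_add_le hx.le hε0 hε1
    · refine Asymptotics.IsBigO.of_bound 1⁻¹ ?_
      filter_upwards [self_mem_nhdsWithin] with x (hx : 0 < x)
      rw [neg_neg, Real.norm_of_nonneg (by positivity : 0 ≤ x ^ (1 : ℝ))]
      exact norm_log_one_add_le hx.le one_pos le_rfl
  obtain ⟨hinv, hinv'⟩ := hasMellin_inv_one_add (s := s + 1) (by simp; linarith) (by simpa using h0)
  refine ⟨hconv, ?_⟩
  rw [mellin] at hinv' ⊢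
  rw [MellinConvergent] at hinv hconv
  simp only [add_sub_cancel_right, smul_eq_mul] at hinv hinv' hconv ⊢
  have hbound : ∀ ε : ℝ, 0 < ε → ε ≤ 1 → ∀ x : ℝ, 0 < x →
      ‖((Real.log (1 + x) : ℝ) : ℂ) * ((x : ℂ) ^ s / s)‖ ≤ ε⁻¹ * ‖s‖⁻¹ * x ^ (s.re + ε) := by
    intro ε h h' x hx
    rw [norm_mul, norm_div, norm_cpow_eq_rpow_re_of_pos hx, Real.rpow_add hx]
    calc _ ≤ ε⁻¹ * x ^ ε * (x ^ s.re / ‖s‖) := by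
          gcongr
          exact norm_log_one_add_le hx.le h h'
      _ = _ := by ring
  have hbot : Tendsto ((fun x : ℝ => ((Real.log (1 + x) : ℝ) : ℂ)) * fun x : ℝ => (x : ℂ) ^ s / s)
      (nhdsWithin 0 (Ioi 0)) (nhds 0) := by
    refine squeeze_zero_norm' (a := fun x : ℝ => 1⁻¹ * ‖s‖⁻¹ * x ^ (s.re + 1)) ?_ ?_
    · filter_upwards [self_mem_nhdsWithin] with x hx
      exact hbound 1 one_pos le_rfl x hx
    · have h : Tendsto (fun x : ℝ => x ^ (s.re + 1)) (nhdsWithin 0 (Ioi 0)) (nhds 0) := by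
        have h' := (Real.continuousAt_rpow_const 0 (s.re + 1) (Or.inr (by linarith))).tendsto
        rw [Real.zero_rpow (by linarith)] at h'
        exact h'.mono_left nhdsWithin_le_nhds
      simpa using h.const_mul (1⁻¹ * ‖s‖⁻¹)
  have htop : Tendsto ((fun x : ℝ => ((Real.log (1 + x) : ℝ) : ℂ)) * fun x : ℝ => (x : ℂ) ^ s / s)
      atTop (nhds 0) := by
    refine squeeze_zero_norm'
      (a := fun x : ℝ => (-s.re / 2)⁻¹ * ‖s‖⁻¹ * x ^ (s.re + -s.re / 2)) ?_ ?_
    · filter_upwards [eventually_gt_atTop 0] with x hx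
      exact hbound _ hε0 hε1 x hx
    · have h := tendsto_rpow_neg_atTop hε0
      rw [show -(-s.re / 2) = s.re + -s.re / 2 by ring] at h
      simpa using h.const_mul ((-s.re / 2)⁻¹ * ‖s‖⁻¹)
  have hlog : ∀ x ∈ Ioi (0 : ℝ), HasDerivAt (fun x : ℝ => ((Real.log (1 + x) : ℝ) : ℂ))
      (1 + (x : ℂ))⁻¹ x := by
    intro x (hx : 0 < x)
    have h := (((hasDerivAt_id x).const_add 1).log (by simp; positivity)).ofReal_comp
    simpa using h
  have hpow : ∀ x ∈ Ioi (0 : ℝ), HasDerivAt (fun x : ℝ => (x : ℂ) ^ s / s) ((x : ℂ) ^ (s - 1)) x := by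
    intro x (hx : 0 < x)
    simpa using hasDerivAt_ofReal_cpow_const' hx.ne' (r := s - 1)
      fun h => hs (by linear_combination h)
  have hparts := integral_Ioi_mul_deriv_eq_deriv_mul hlog hpow
    (by
      refine hconv.congr_fun (fun x _ => ?_) measurableSet_Ioi
      simp [mul_comm])
    (by
      refine IntegrableOn.congr_fun (hinv.div_const s) (fun x _ => ?_) measurableSet_Ioi
      simp only [Pi.mul_apply]
      ring)
    hbot htop
  rw [sub_zero, zero_sub] at hparts
  calc _ = ∫ x in Ioi (0 : ℝ), ((Real.log (1 + x) : ℝ) : ℂ) * (x : ℂ) ^ (s - 1) := by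
        simp only [mul_comm]
    _ = -((∫ x in Ioi (0 : ℝ), (x : ℂ) ^ s * (1 + (x : ℂ))⁻¹) / s) := by
        rw [hparts, ← integral_div]
        congr 2
        ext x
        ring
    _ = _ := by
        rw [hinv', mul_add, mul_one, Complex.sin_add_pi, div_neg, neg_div, neg_neg, div_div,
          mul_comm s]

theorem norm_sin_pi_mul_ge (c t : ℝ) :
    |Real.sin (π * c)| * (1 + t ^ 2) ≤ ‖Complex.sin (π * ((c : ℂ) + t * Complex.I))‖ := by
  have hre : (Complex.sin (π * ((c : ℂ) + t * Complex.I))).re =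
      Real.sin (π * c) * Real.cosh (π * t) := by
    rw [mul_add, ← mul_assoc, Complex.sin_add_mul_I, ← ofReal_mul, ← ofReal_mul, ← ofReal_sin,
      ← ofReal_cosh, ← ofReal_cos, ← ofReal_sinh]
    simp only [add_re, mul_re, mul_im, ofReal_re, ofReal_im, I_re, I_im]
    ring
  have hcosh : 1 + t ^ 2 ≤ Real.cosh (π * t) := by
    have h : 1 + (π * t) ^ 2 / 2 ≤ Real.cosh (π * t) := by
      have hsinh : (π * t / 2) ^ 2 ≤ Real.sinh (π * t / 2) ^ 2 := by
        rw [sq_le_sq, Real.abs_sinh]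
        exact Real.self_le_sinh_iff.mpr (abs_nonneg _)
      have hdouble := Real.cosh_two_mul (π * t / 2)
      rw [Real.cosh_sq, mul_div_cancel₀ _ two_ne_zero] at hdouble
      linarith
    nlinarith [Real.pi_gt_three, sq_nonneg t, mul_nonneg (sq_nonneg t) (sq_nonneg (π - 3))]
  calc _ ≤ |Real.sin (π * c)| * Real.cosh (π * t) := by gcongr
    _ = |(Complex.sin (π * ((c : ℂ) + t * Complex.I))).re| := by
        rw [hre, abs_mul, abs_of_pos (Real.cosh_pos _)]
    _ ≤ _ := abs_re_le_norm _

theorem real_sin_pi_mul_ne_zero {c : ℝ} (hc1 : -1 < c) (hc0 : c < 0) : Real.sin (π * c) ≠ 0 := by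
  refine (Real.sin_neg_of_neg_of_neg_pi_lt ?_ ?_).ne <;> nlinarith [Real.pi_pos]

/-- Mellin inversion for `log (1 + x)`. -/
theorem log_one_add_eq_integral {c x : ℝ} (hc1 : -1 < c) (hc0 : c < 0) (hx : 0 < x) :
    ((Real.log (1 + x) : ℝ) : ℂ) = ((1 / (2 * π) : ℝ) : ℂ) * ∫ t : ℝ,
      (π : ℝ) / (((c : ℂ) + t * Complex.I) * Complex.sin (π * ((c : ℂ) + t * Complex.I))) *
        (x : ℂ) ^ (-((c : ℂ) + t * Complex.I)) := by
  have hM : ∀ t : ℝ, HasMellin (fun x : ℝ => ((Real.log (1 + x) : ℝ) : ℂ))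
      ((c : ℂ) + t * Complex.I) (π / (((c : ℂ) + t * Complex.I) *
        Complex.sin (π * ((c : ℂ) + t * Complex.I)))) := fun t =>
    hasMellin_log_one_add (by simpa using hc1) (by simpa using hc0)
  have hsin := real_sin_pi_mul_ne_zero hc1 hc0
  have hne : ∀ t : ℝ, ((c : ℂ) + t * Complex.I) *
      Complex.sin (π * ((c : ℂ) + t * Complex.I)) ≠ 0 := by
    intro t
    refine mul_ne_zero (fun h => ?_) (fun h => ?_)
    · have := congrArg Complex.re h
      simp at this
      exact hc0.ne this
    · have := norm_sin_pi_mul_ge c t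
      rw [h, norm_zero] at this
      have h' : 0 < |Real.sin (π * c)| * (1 + t ^ 2) := by positivity
      linarith
  have hint : VerticalIntegrable (mellin fun x : ℝ => ((Real.log (1 + x) : ℝ) : ℂ)) c := by
    rw [VerticalIntegrable]
    simp only [fun t => (hM t).2]
    refine (integrable_inv_one_add_sq.const_mul (π / (|c| * |Real.sin (π * c)|))).mono'
      (Continuous.aestronglyMeasurable ?_) (ae_of_all _ fun t => ?_)
    · exact continuous_const.div (by fun_prop) hne
    · have hc : |c| ≤ ‖(c : ℂ) + t * Complex.I‖ := by
        simpa using abs_re_le_norm ((c : ℂ) + t * Complex.I)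
      have hc' : 0 < |c| := abs_pos.mpr hc0.ne
      rw [norm_div, norm_mul, norm_real, Real.norm_of_nonneg Real.pi_pos.le]
      calc _ ≤ π / (|c| * (|Real.sin (π * c)| * (1 + t ^ 2))) := by
            gcongr
            exact norm_sin_pi_mul_ge c t
        _ = _ := by field_simp
  have hcontAt : ContinuousAt (fun x : ℝ => ((Real.log (1 + x) : ℝ) : ℂ)) x :=
    continuous_ofReal.continuousAt.comp
      (ContinuousAt.log (by fun_prop) (by positivity))
  have h := mellinInv_mellin_eq c _ hx (by simpa using (hM 0).1) hint hcontAt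
  rw [← h, mellinInv, real_smul]
  congr 2
  ext t
  rw [(hM t).2, smul_eq_mul, mul_comm]

theorem toReal_measure_le_eq_setIntegral {Ω : Type*} [MeasurableSpace Ω] {μ : Measure Ω}
    {X : Ω → ℝ} {f : ℝ → ℝ} (hX0 : ∀ ω, 0 ≤ X ω) (hf : Measurable f) (hf0 : ∀ x, 0 ≤ f x)
    (hXf : HasDensity μ X f) (x : ℝ) :
    (μ {ω | X ω ≤ x}).toReal = ∫ u in Ioc 0 x, f u := by
  have hset : {ω | X ω ≤ x} = X ⁻¹' Icc 0 x := by
    ext ω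
    simp [hX0 ω]
  rw [hset, ← Measure.map_apply hXf.1 measurableSet_Icc, hXf.2,
    withDensity_apply _ measurableSet_Icc, ← integral_Icc_eq_integral_Ioc,
    integral_eq_lintegral_of_nonneg_ae (ae_of_all _ hf0) hf.aestronglyMeasurable]

theorem setIntegral_Ioc_foxH {f : ℝ → ℝ} {κ lam c x : ℝ} {D : FoxData}
    (hf : IsFoxDensity f κ lam D c) (hc : c < 1) (hx : 0 < x) :
    ((∫ u in Ioc 0 x, f u : ℝ) : ℂ) = (κ : ℂ) / (2 * (π : ℝ)) * ∫ t : ℝ,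
      D.kernel ((c : ℂ) + (t : ℂ) * Complex.I) *
        (lam : ℂ) ^ (-((c : ℂ) + (t : ℂ) * Complex.I)) *
        (x : ℂ) ^ (1 - ((c : ℂ) + (t : ℂ) * Complex.I)) /
        (1 - ((c : ℂ) + (t : ℂ) * Complex.I)) := by
  obtain ⟨-, hlam, -, hint, -, hrep, -, -⟩ := hf
  have hlam' : (lam : ℂ) ≠ 0 := by exact_mod_cast hlam.ne'
  have hprod : Integrable (Function.uncurry fun (u t : ℝ) =>
      D.kernel ((c : ℂ) + (t : ℂ) * Complex.I) *
        (lam : ℂ) ^ (-((c : ℂ) + (t : ℂ) * Complex.I)) *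
        (u : ℂ) ^ (-((c : ℂ) + (t : ℂ) * Complex.I))) ((volume.restrict (Ioc 0 x)).prod volume) := by
    have hu : IntegrableOn (fun u : ℝ => u ^ (-c)) (Ioc 0 x) := by
      rw [← intervalIntegrable_iff_integrableOn_Ioc_of_le hx.le]
      exact intervalIntegral.intervalIntegrable_rpow' (by linarith)
    refine (hu.mul_prod (hint.norm.const_mul (lam ^ (-c)))).mono' ?_ ?_
    · refine (hint.aestronglyMeasurable.comp_snd.mul ?_).mul ?_
      · exact (Measurable.const_pow (by fun_prop) _).aestronglyMeasurable
      · exact (Measurable.pow (by fun_prop) (by fun_prop)).aestronglyMeasurable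
    · have h : ∀ᵐ p : ℝ × ℝ ∂((volume.restrict (Ioc 0 x)).prod volume), p.1 ∈ Ioc 0 x :=
        Measure.quasiMeasurePreserving_fst.ae (ae_restrict_mem measurableSet_Ioc)
      filter_upwards [h] with p hp
      simp only [Function.uncurry]
      rw [norm_mul, norm_mul, norm_cpow_eq_rpow_re_of_pos hlam, norm_cpow_eq_rpow_re_of_pos hp.1]
      simp only [neg_re, add_re, ofReal_re, mul_re, I_re, mul_zero, ofReal_im, I_im, mul_one,
        sub_self, add_zero]
      exact le_of_eq (by ring)
  rw [← integral_complex_ofReal]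
  calc _ = ∫ u in Ioc 0 x, (κ : ℂ) / (2 * (π : ℝ)) * ∫ t : ℝ,
        D.kernel ((c : ℂ) + (t : ℂ) * Complex.I) *
        (lam : ℂ) ^ (-((c : ℂ) + (t : ℂ) * Complex.I)) *
        (u : ℂ) ^ (-((c : ℂ) + (t : ℂ) * Complex.I)) := by
        refine setIntegral_congr_fun measurableSet_Ioc fun u hu => ?_
        rw [hrep u hu.1]
        congr 2
        ext t
        rw [ofReal_mul, mul_cpow_ofReal_nonneg hlam.le hu.1.le]
        ring
    _ = _ := by
        rw [integral_const_mul, integral_integral_swap hprod]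
        congr 2
        ext t
        have hne : -((c : ℂ) + (t : ℂ) * Complex.I) + 1 ≠ 0 := by
          intro h
          have := congrArg Complex.re h
          simp at this
          linarith
        rw [integral_const_mul, ← intervalIntegral.integral_of_le hx.le,
          integral_cpow (Or.inl (by simpa using hc)), ofReal_zero, zero_cpow hne, sub_zero,
          neg_add_eq_sub, mul_div_assoc]

/-- **First term of the average secrecy capacity (Theorem 4, eq. (21a)).**
For independent `γ_B, γ_E` with Fox H-function densities `f_B, f_E`, `0 < c_E < 1`,
`F_E` the CDF of `γ_E`, `c ∈ (−1,0)`, the Mellin transform of `f_B` equal to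
`κ_B λ_B^{−s} Θ_B(s)` on `Re s = 2 − c_E − c`, and assuming Fubini's theorem applies,
`∫₀^∞ ln(1+x) f_B(x) F_E(x) dx = (κ_B κ_E/λ_B²)(1/(2π))² ∫∫ Θ_B(2−ξ−z) Θ_E(ξ)
[π/(z sin(πz))] [1/(1−ξ)] (λ_E/λ_B)^{−ξ} λ_B^{z} dt' dt`, `ξ = c_E+it`, `z = c+it'`. -/
theorem asc_I1_foxH {Ω : Type*} [MeasurableSpace Ω] (μ : Measure Ω)
    [IsProbabilityMeasure μ] (γB γE : Ω → ℝ)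
    (hB0 : ∀ ω, 0 ≤ γB ω) (hE0 : ∀ ω, 0 ≤ γE ω)
    (hIndep : ProbabilityTheory.IndepFun γB γE μ)
    (fB fE : ℝ → ℝ) (κB lamB cB κE lamE cE c : ℝ) (DB DE : FoxData)
    (hfB : IsFoxDensity fB κB lamB DB cB) (hBf : HasDensity μ γB fB)
    (hfE : IsFoxDensity fE κE lamE DE cE) (hEf : HasDensity μ γE fE)
    (hcE0 : 0 < cE) (hcE1 : cE < 1) (hc1 : -1 < c) (hc0 : c < 0)
    (hMellinB : ∀ z : ℂ, z.re = 2 - cE - c →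
      IntegrableOn (fun x : ℝ => (x : ℂ) ^ (z - 1) * (fB x : ℂ)) (Ioi 0) ∧
        ∫ x in Ioi (0 : ℝ), (x : ℂ) ^ (z - 1) * (fB x : ℂ) =
          (κB : ℂ) * (lamB : ℂ) ^ (-z) * DB.kernel z)
    (hFub : IntegrableOn
      (fun p : ℝ × ℝ × ℝ =>
        (fB p.1 : ℂ) *
          (DE.kernel ((cE : ℂ) + (p.2.1 : ℂ) * Complex.I) *
            (lamE : ℂ) ^ (-((cE : ℂ) + (p.2.1 : ℂ) * Complex.I)) *
            (p.1 : ℂ) ^ (1 - ((cE : ℂ) + (p.2.1 : ℂ) * Complex.I)) /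
            (1 - ((cE : ℂ) + (p.2.1 : ℂ) * Complex.I))) *
          (((π : ℝ) / (((c : ℂ) + (p.2.2 : ℂ) * Complex.I) *
              Complex.sin ((π : ℝ) * ((c : ℂ) + (p.2.2 : ℂ) * Complex.I)))) *
            (p.1 : ℂ) ^ (-((c : ℂ) + (p.2.2 : ℂ) * Complex.I))))
      (Ioi (0 : ℝ) ×ˢ (univ : Set (ℝ × ℝ)))) :
    ((∫ x in Ioi (0 : ℝ), Real.log (1 + x) * fB x * (μ {ω | γE ω ≤ x}).toReal : ℝ) : ℂ) =
      ((κB * κE / lamB ^ 2 : ℝ) : ℂ) * ((1 / (2 * (π : ℝ)) : ℝ) : ℂ) ^ 2 *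
        ∫ t : ℝ, ∫ t' : ℝ,
          DB.kernel (2 - ((cE : ℂ) + (t : ℂ) * Complex.I) -
              ((c : ℂ) + (t' : ℂ) * Complex.I)) *
            DE.kernel ((cE : ℂ) + (t : ℂ) * Complex.I) *
            ((π : ℝ) / (((c : ℂ) + (t' : ℂ) * Complex.I) *
              Complex.sin ((π : ℝ) * ((c : ℂ) + (t' : ℂ) * Complex.I)))) *
            (1 / (1 - ((cE : ℂ) + (t : ℂ) * Complex.I))) *
            ((lamE / lamB : ℝ) : ℂ) ^ (-((cE : ℂ) + (t : ℂ) * Complex.I)) *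
            (lamB : ℂ) ^ ((c : ℂ) + (t' : ℂ) * Complex.I) := by
  obtain ⟨-, hlamB, -⟩ := hfB
  have hlamE := hfE.2.1
  have hlamB' : (lamB : ℂ) ≠ 0 := by exact_mod_cast hlamB.ne'
  rw [IntegrableOn, Measure.volume_eq_prod, ← Measure.prod_restrict, Measure.restrict_univ] at hFub
  rw [← integral_complex_ofReal]
  calc _ = ∫ x in Ioi (0 : ℝ), ((κE : ℂ) / (2 * (π : ℝ)) * ((1 / (2 * (π : ℝ)) : ℝ) : ℂ)) *
        ∫ p : ℝ × ℝ, (fB x : ℂ) *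
          (DE.kernel ((cE : ℂ) + (p.1 : ℂ) * Complex.I) *
            (lamE : ℂ) ^ (-((cE : ℂ) + (p.1 : ℂ) * Complex.I)) *
            (x : ℂ) ^ (1 - ((cE : ℂ) + (p.1 : ℂ) * Complex.I)) /
            (1 - ((cE : ℂ) + (p.1 : ℂ) * Complex.I))) *
          (((π : ℝ) / (((c : ℂ) + (p.2 : ℂ) * Complex.I) *
              Complex.sin ((π : ℝ) * ((c : ℂ) + (p.2 : ℂ) * Complex.I)))) *
            (x : ℂ) ^ (-((c : ℂ) + (p.2 : ℂ) * Complex.I))) := by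
        refine setIntegral_congr_fun measurableSet_Ioi fun x (hx : 0 < x) => ?_
        simp only [mul_assoc (fB x : ℂ)]
        rw [integral_const_mul, Measure.volume_eq_prod,
          integral_prod_mul
            (fun t : ℝ => DE.kernel ((cE : ℂ) + (t : ℂ) * Complex.I) *
              (lamE : ℂ) ^ (-((cE : ℂ) + (t : ℂ) * Complex.I)) *
              (x : ℂ) ^ (1 - ((cE : ℂ) + (t : ℂ) * Complex.I)) /
              (1 - ((cE : ℂ) + (t : ℂ) * Complex.I)))
            (fun t : ℝ => ((π : ℝ) / (((c : ℂ) + (t : ℂ) * Complex.I) *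
              Complex.sin ((π : ℝ) * ((c : ℂ) + (t : ℂ) * Complex.I)))) *
              (x : ℂ) ^ (-((c : ℂ) + (t : ℂ) * Complex.I))),
          toReal_measure_le_eq_setIntegral hE0 hfE.2.2.1 hfE.2.2.2.2.2.2.1 hEf, ofReal_mul,
          ofReal_mul, setIntegral_Ioc_foxH hfE hcE1 hx, log_one_add_eq_integral hc1 hc0 hx]
        ring
    _ = ((κE : ℂ) / (2 * (π : ℝ)) * ((1 / (2 * (π : ℝ)) : ℝ) : ℂ)) *
        ∫ t : ℝ, ∫ t' : ℝ, ∫ x in Ioi (0 : ℝ), (fB x : ℂ) *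
          (DE.kernel ((cE : ℂ) + (t : ℂ) * Complex.I) *
            (lamE : ℂ) ^ (-((cE : ℂ) + (t : ℂ) * Complex.I)) *
            (x : ℂ) ^ (1 - ((cE : ℂ) + (t : ℂ) * Complex.I)) /
            (1 - ((cE : ℂ) + (t : ℂ) * Complex.I))) *
          (((π : ℝ) / (((c : ℂ) + (t' : ℂ) * Complex.I) *
              Complex.sin ((π : ℝ) * ((c : ℂ) + (t' : ℂ) * Complex.I)))) *
            (x : ℂ) ^ (-((c : ℂ) + (t' : ℂ) * Complex.I))) := by
        have hswap := hFub.integral_prod_right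
        rw [integral_const_mul, integral_integral_swap hFub]
        rw [Measure.volume_eq_prod] at hswap ⊢
        rw [integral_prod _ hswap]
    _ = _ := by
        rw [show ((κB * κE / lamB ^ 2 : ℝ) : ℂ) * ((1 / (2 * (π : ℝ)) : ℝ) : ℂ) ^ 2 =
          ((κE : ℂ) / (2 * (π : ℝ)) * ((1 / (2 * (π : ℝ)) : ℝ) : ℂ)) * (κB / lamB ^ 2) by
            push_cast; ring, mul_assoc _ ((κB : ℂ) / lamB ^ 2)]
        simp only [← integral_const_mul ((κB : ℂ) / lamB ^ 2)]
        congr 2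
        ext t
        congr 1
        ext t'
        set ξ : ℂ := (cE : ℂ) + (t : ℂ) * Complex.I with hξ
        set z : ℂ := (c : ℂ) + (t' : ℂ) * Complex.I with hz
        have hre : (2 - ξ - z).re = 2 - cE - c := by simp [hξ, hz]
        have hratio : ((lamE / lamB : ℝ) : ℂ) ^ (-ξ) = (lamE : ℂ) ^ (-ξ) * (lamB : ℂ) ^ ξ := by
          rw [div_eq_mul_inv, ofReal_mul, mul_cpow_ofReal_nonneg hlamE.le (by positivity),
            ofReal_inv, Complex.inv_cpow, cpow_neg, cpow_neg, inv_inv]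
          rw [arg_ofReal_of_nonneg hlamB.le]
          exact Real.pi_pos.ne
        have hpow : (lamB : ℂ) ^ (-(2 - ξ - z)) = (lamB : ℂ) ^ ξ * (lamB : ℂ) ^ z / lamB ^ 2 := by
          rw [show -(2 - ξ - z) = ξ + z - (2 : ℕ) by push_cast; ring, cpow_sub _ _ hlamB',
            cpow_add _ _ hlamB', cpow_natCast]
        calc _ = ∫ x in Ioi (0 : ℝ), (DE.kernel ξ * (lamE : ℂ) ^ (-ξ) / (1 - ξ) *
              ((π : ℝ) / (z * Complex.sin ((π : ℝ) * z)))) *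
              ((x : ℂ) ^ (2 - ξ - z - 1) * (fB x : ℂ)) := by
              refine setIntegral_congr_fun measurableSet_Ioi fun x (hx : 0 < x) => ?_
              rw [show 2 - ξ - z - 1 = (1 - ξ) + -z by ring,
                cpow_add _ _ (by exact_mod_cast hx.ne')]
              ring
          _ = _ := by
              rw [integral_const_mul, (hMellinB _ hre).2, hratio, hpow]
              ring
end
end

section
/- Mellin transform of a product of Mellin–Barnes kernels (the key lemma behind the colluding-eavesdropper theorems): For r = 1, …, L let Θ_r be Fox H-kernels and c_r ∈ ℝ be such that t ↦ Θ_r(c_r+it) is absolutely integrable and the line Re s = c_r contains no pole of Θ_r; define h_r(x) = (1/(2π)) ∫_ℝ Θ_r(c_r+it) x^{−(c_r+it)} dt for x > 0. Assume ∫₀^∞ x^{z−1} h_1(x) dx converges absolutely and equals Θ_1(z) for all z with Re z = c_1. Let a_1, …, a_L > 0 and let σ ∈ ℂ with Re σ = c_1 + c_2 + ⋯ + c_L. If all iterated integrals converge absolutely (so Fubini's theorem applies), then ∫₀^∞ x^{σ−1} ∏_{r=1}^{L} h_r(a_r x) dx = (1/(2π))^{L−1} ∫_ℝ ⋯ ∫_ℝ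 Θ_1(σ − s_2 − ⋯ − s_L) a_1^{s_2 + ⋯ + s_L − σ} ∏_{r=2}^{L} [Θ_r(s_r) a_r^{−s_r}] dt_2 ⋯ dt_L, where s_r = c_r + it_r. -/
open MeasureTheory Complex Set Filter
open scoped Real

noncomputable section

/-- **Mellin transform of a product of Mellin–Barnes kernels** (the key lemma behind the
colluding-eavesdropper theorems). Here the `L = N + 1` kernels of the paper are the
distinguished kernel `Θ₀` (the paper's `Θ_1`) together with the family `Θ_j`, `j : Fin N`
(the paper's `Θ_2, …, Θ_L`); each `h` is the Mellin–Barnes integral of its kernel along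
its line, the Mellin transform of `h₀` equals `Θ₀` on the line `Re z = c₀`, `σ` lies on
the line `Re σ = c₀ + Σ_j c_j`, and all `a`'s are positive. If Fubini's theorem applies,
then `∫₀^∞ x^{σ−1} ∏_r h_r(a_r x) dx = (1/(2π))^{L−1} ∫⋯∫ Θ₀(σ − Σ s_j)
a₀^{Σ s_j − σ} ∏_j Θ_j(s_j) a_j^{−s_j} dt_1 ⋯ dt_N`, `s_j = c_j + i t_j`. -/
theorem mellin_prod_mellinBarnes (N : ℕ)
    (D₀ : FoxData) (c₀ : ℝ) (D : Fin N → FoxData) (c : Fin N → ℝ)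
    (hInt₀ : Integrable (fun t : ℝ => D₀.kernel ((c₀ : ℂ) + (t : ℂ) * Complex.I)))
    (hNoPole₀ : D₀.noPoleOn c₀)
    (hIntj : ∀ j, Integrable (fun t : ℝ => (D j).kernel ((c j : ℂ) + (t : ℂ) * Complex.I)))
    (hNoPolej : ∀ j, (D j).noPoleOn (c j))
    (h₀ : ℝ → ℂ) (h : Fin N → ℝ → ℂ)
    (hh₀ : ∀ x : ℝ, 0 < x → h₀ x = 1 / (2 * (π : ℝ)) *
      ∫ t : ℝ, D₀.kernel ((c₀ : ℂ) + (t : ℂ) * Complex.I) *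
        (x : ℂ) ^ (-((c₀ : ℂ) + (t : ℂ) * Complex.I)))
    (hh : ∀ j, ∀ x : ℝ, 0 < x → h j x = 1 / (2 * (π : ℝ)) *
      ∫ t : ℝ, (D j).kernel ((c j : ℂ) + (t : ℂ) * Complex.I) *
        (x : ℂ) ^ (-((c j : ℂ) + (t : ℂ) * Complex.I)))
    (hMellin₀ : ∀ z : ℂ, z.re = c₀ →
      IntegrableOn (fun x : ℝ => (x : ℂ) ^ (z - 1) * h₀ x) (Ioi 0) ∧
        ∫ x in Ioi (0 : ℝ), (x : ℂ) ^ (z - 1) * h₀ x = D₀.kernel z)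
    (a₀ : ℝ) (a : Fin N → ℝ) (ha₀ : 0 < a₀) (ha : ∀ j, 0 < a j)
    (σ : ℂ) (hσ : σ.re = c₀ + ∑ j, c j)
    (hFub : IntegrableOn
      (fun p : ℝ × (Fin N → ℝ) =>
        (p.1 : ℂ) ^ (σ - 1) * h₀ (a₀ * p.1) *
          ∏ j, (D j).kernel ((c j : ℂ) + (p.2 j : ℂ) * Complex.I) *
            ((a j * p.1 : ℝ) : ℂ) ^ (-((c j : ℂ) + (p.2 j : ℂ) * Complex.I)))
      (Ioi (0 : ℝ) ×ˢ (univ : Set (Fin N → ℝ)))) :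
    ∫ x in Ioi (0 : ℝ), (x : ℂ) ^ (σ - 1) * (h₀ (a₀ * x) * ∏ j, h j (a j * x)) =
      ((1 / (2 * (π : ℝ)) : ℝ) : ℂ) ^ N *
        ∫ t : Fin N → ℝ,
          D₀.kernel (σ - ∑ j, ((c j : ℂ) + (t j : ℂ) * Complex.I)) *
            (a₀ : ℂ) ^ ((∑ j, ((c j : ℂ) + (t j : ℂ) * Complex.I)) - σ) *
            ∏ j, (D j).kernel ((c j : ℂ) + (t j : ℂ) * Complex.I) *
              (a j : ℂ) ^ (-((c j : ℂ) + (t j : ℂ) * Complex.I)) := by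
  set κ : ℂ := ((1 / (2 * (π : ℝ)) : ℝ) : ℂ) with hκ
  set F : ℝ → (Fin N → ℝ) → ℂ := fun x t => (x : ℂ) ^ (σ - 1) * h₀ (a₀ * x) *
    ∏ j, (D j).kernel ((c j : ℂ) + (t j : ℂ) * Complex.I) *
      ((a j * x : ℝ) : ℂ) ^ (-((c j : ℂ) + (t j : ℂ) * Complex.I)) with hF
  have expand : ∀ x ∈ Ioi (0 : ℝ),
      (x : ℂ) ^ (σ - 1) * (h₀ (a₀ * x) * ∏ j, h j (a j * x)) = κ ^ N * ∫ t, F x t := by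
    intro x hx
    have hprod : ∏ j, h j (a j * x) = κ ^ N * ∫ t : Fin N → ℝ,
        ∏ j, (D j).kernel ((c j : ℂ) + (t j : ℂ) * Complex.I) *
          ((a j * x : ℝ) : ℂ) ^ (-((c j : ℂ) + (t j : ℂ) * Complex.I)) := by
      rw [integral_fintype_prod_volume_eq_prod (fun j (t : ℝ) =>
        (D j).kernel ((c j : ℂ) + (t : ℂ) * Complex.I) *
          ((a j * x : ℝ) : ℂ) ^ (-((c j : ℂ) + (t : ℂ) * Complex.I))),
        Finset.prod_congr rfl fun j _ => hh j (a j * x) (mul_pos (ha j) hx),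
        Finset.prod_mul_distrib, Finset.prod_const, Finset.card_univ, Fintype.card_fin, hκ]
      push_cast
      rfl
    simp only [hF]
    rw [hprod, integral_const_mul]
    ring
  have inner : ∀ t : Fin N → ℝ, ∫ x in Ioi (0 : ℝ), F x t =
      D₀.kernel (σ - ∑ j, ((c j : ℂ) + (t j : ℂ) * Complex.I)) *
        (a₀ : ℂ) ^ ((∑ j, ((c j : ℂ) + (t j : ℂ) * Complex.I)) - σ) *
        ∏ j, (D j).kernel ((c j : ℂ) + (t j : ℂ) * Complex.I) *
          (a j : ℂ) ^ (-((c j : ℂ) + (t j : ℂ) * Complex.I)) := by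
    intro t
    set S : ℂ := ∑ j, ((c j : ℂ) + (t j : ℂ) * Complex.I) with hS
    set P : ℂ := ∏ j, (D j).kernel ((c j : ℂ) + (t j : ℂ) * Complex.I) *
          (a j : ℂ) ^ (-((c j : ℂ) + (t j : ℂ) * Complex.I)) with hP
    have hre : (σ - S).re = c₀ := by simp [hS, hσ]
    have hpt : ∀ x ∈ Ioi (0 : ℝ),
        F x t = P * ((x : ℂ) ^ (σ - S - 1) • h₀ (a₀ * x)) := by
      intro x hx
      have hx0 : (x : ℂ) ≠ 0 := by exact_mod_cast (ne_of_gt hx)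
      have hpow : ∏ j, (x : ℂ) ^ (-((c j : ℂ) + (t j : ℂ) * Complex.I)) = (x : ℂ) ^ (-S) := by
        rw [hS, ← Finset.sum_neg_distrib, Complex.cpow_def_of_ne_zero hx0, Finset.mul_sum,
          Complex.exp_sum]
        exact Finset.prod_congr rfl fun j _ => Complex.cpow_def_of_ne_zero hx0 _
      have hsplit : ∏ j, (D j).kernel ((c j : ℂ) + (t j : ℂ) * Complex.I) *
          ((a j * x : ℝ) : ℂ) ^ (-((c j : ℂ) + (t j : ℂ) * Complex.I)) = P * (x : ℂ) ^ (-S) := by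
        rw [← hpow, hP, ← Finset.prod_mul_distrib]
        refine Finset.prod_congr rfl fun j _ => ?_
        rw [Complex.ofReal_mul, Complex.mul_cpow_ofReal_nonneg (ha j).le (le_of_lt hx), mul_assoc]
      simp only [hF]
      rw [hsplit, smul_eq_mul, show σ - S - 1 = (σ - 1) + -S by ring, Complex.cpow_add _ _ hx0]
      ring
    have hmellin := mellin_comp_mul_left h₀ (σ - S) ha₀
    simp only [mellin] at hmellin
    rw [setIntegral_congr_fun measurableSet_Ioi hpt, integral_const_mul, hmellin]
    simp only [smul_eq_mul]
    rw [(hMellin₀ (σ - S) hre).2, neg_sub]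
    ring
  have hint : Integrable (Function.uncurry F)
      ((volume.restrict (Ioi (0 : ℝ))).prod (volume : Measure (Fin N → ℝ))) := by
    rw [IntegrableOn, Measure.volume_eq_prod, ← Measure.prod_restrict, Measure.restrict_univ]
      at hFub
    exact hFub
  rw [setIntegral_congr_fun measurableSet_Ioi expand, integral_const_mul,
    integral_integral_swap hint]
  simp only [inner]
end
end

section
/- Asymptotic secrecy outage probability over α-μ wiretap fading channels (eq. (25)): For α, μ, λ > 0 let g_{α,μ,λ}(x) = (α λ^{αμ}/Γ(μ)) x^{αμ−1} exp(−(λx)^{α}) for x > 0 be the α-μ SNR density with scale λ. Fix α_B, μ_B, α_E, μ_E, λ_E > 0 and R_s ≥ 1. Let Y be a random variable with density g_{α_E,μ_E,λ_E}, and for each λ_B > 0 let X_{λ_B} be a random variable with density g_{α_B,μ_B,λ_B}, independent of Y. Then lim_{λ_B → 0⁺} Pr(X_{λ_B} ≤ R_s Y) / λ_B^{α_B μ_B} = [Γ(μ_E + α_B μ_B/α_E) / (Γ(1+μ_B) Γ(μ_E))] · (R_s/λ_E)^{α_B μ_B}. -/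
open MeasureTheory Complex Set Filter
open scoped Real

noncomputable section

/-- The α-μ SNR density with parameters `α, μ` and scale `λ`:
`g(x) = (α λ^{αμ}/Γ(μ)) x^{αμ−1} exp(−(λx)^α)` for `x > 0`, and `0` otherwise. -/
noncomputable def alphaMuPdf (α μ lam : ℝ) (x : ℝ) : ℝ :=
  if 0 < x then α * lam ^ (α * μ) / Real.Gamma μ * x ^ (α * μ - 1) *
    Real.exp (-(lam * x) ^ α) else 0

/-- The small-scale envelope of the α-μ density: `alphaMuPdf α μ l x` divided by
`l ^ (α * μ)`, in the limit `l → 0`. -/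
def alphaMuEnvelope (α μ x : ℝ) : ℝ :=
  if 0 < x then α / Real.Gamma μ * x ^ (α * μ - 1) else 0

lemma alphaMuEnvelope_nonneg {α μ : ℝ} (hα : 0 < α) (hμ : 0 < μ) (x : ℝ) :
    0 ≤ alphaMuEnvelope α μ x := by
  have := Real.Gamma_pos_of_pos hμ
  unfold alphaMuEnvelope
  split_ifs <;> positivity

@[fun_prop]
lemma measurable_alphaMuEnvelope (α μ : ℝ) : Measurable (alphaMuEnvelope α μ) := by
  unfold alphaMuEnvelope
  exact Measurable.ite measurableSet_Ioi (by fun_prop) (by fun_prop)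

@[fun_prop]
lemma measurable_alphaMuPdf (α μ l : ℝ) : Measurable (alphaMuPdf α μ l) := by
  unfold alphaMuPdf
  exact Measurable.ite measurableSet_Ioi (by fun_prop) (by fun_prop)

lemma alphaMuPdf_eq_rpow_mul (α μ l x : ℝ) :
    alphaMuPdf α μ l x =
      l ^ (α * μ) * (alphaMuEnvelope α μ x * Real.exp (-(l * x) ^ α)) := by
  unfold alphaMuPdf alphaMuEnvelope
  split_ifs <;> ring

lemma alphaMuEnvelope_mul_exp_le {α μ l : ℝ} (hα : 0 < α) (hμ : 0 < μ) (hl : 0 < l) (x : ℝ) :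
    alphaMuEnvelope α μ x * Real.exp (-(l * x) ^ α) ≤ alphaMuEnvelope α μ x := by
  by_cases hx : 0 < x
  · refine mul_le_of_le_one_right (alphaMuEnvelope_nonneg hα hμ x) (Real.exp_le_one_iff.2 ?_)
    have : 0 ≤ (l * x) ^ α := by positivity
    linarith
  · simp [alphaMuEnvelope, hx]

lemma tendsto_alphaMuEnvelope_mul_exp {α : ℝ} (μ : ℝ) (hα : 0 < α) (x : ℝ) :
    Tendsto (fun l : ℝ => alphaMuEnvelope α μ x * Real.exp (-(l * x) ^ α))
      (nhdsWithin 0 (Ioi 0)) (nhds (alphaMuEnvelope α μ x)) := by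
  have hc : Continuous (fun l : ℝ => alphaMuEnvelope α μ x * Real.exp (-(l * x) ^ α)) :=
    continuous_const.mul (Real.continuous_exp.comp
      ((Real.continuous_rpow_const hα.le).comp (by fun_prop : Continuous fun l => l * x)).neg)
  simpa [Real.zero_rpow hα.ne'] using (hc.tendsto 0).mono_left nhdsWithin_le_nhds

lemma withDensity_alphaMuEnvelope_Iic {α μ t : ℝ} (hα : 0 < α) (hμ : 0 < μ) (ht : 0 < t) :
    volume.withDensity (fun x => ENNReal.ofReal (alphaMuEnvelope α μ x)) (Iic t) =
      ENNReal.ofReal (t ^ (α * μ) / Real.Gamma (1 + μ)) := by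
  have hΓ := Real.Gamma_pos_of_pos hμ
  have hp : 0 < α * μ := by positivity
  have hind : (fun x => ENNReal.ofReal (alphaMuEnvelope α μ x)) =
      (Ioi 0).indicator (fun x => ENNReal.ofReal (α / Real.Gamma μ * x ^ (α * μ - 1))) := by
    ext x
    by_cases hx : 0 < x <;> simp [alphaMuEnvelope, hx]
  have hint : IntegrableOn (fun x : ℝ => α / Real.Gamma μ * x ^ (α * μ - 1)) (Ioc 0 t) :=
    ((intervalIntegrable_iff_integrableOn_Ioc_of_le ht.le).1
      (intervalIntegral.intervalIntegrable_rpow' (by linarith))).const_mul _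
  rw [withDensity_apply _ measurableSet_Iic, hind,
    setLIntegral_indicator measurableSet_Ioi, Ioi_inter_Iic,
    ← ofReal_integral_eq_lintegral_ofReal hint, integral_const_mul,
    ← intervalIntegral.integral_of_le ht.le, integral_rpow (Or.inl (by linarith)),
    sub_add_cancel, Real.zero_rpow hp.ne', add_comm 1 μ, Real.Gamma_add_one hμ.ne']
  · congr 1
    field_simp
    ring
  · filter_upwards [ae_restrict_mem measurableSet_Ioc] with x hx
    have := hx.1
    simp only [Pi.zero_apply]
    positivity

lemma lintegral_rpow_withDensity_alphaMuPdf {α μ l p c : ℝ} (hα : 0 < α) (hμ : 0 < μ)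
    (hl : 0 < l) (hp : 0 < p) (hc : 0 < c) :
    ∫⁻ y, ENNReal.ofReal ((c * y) ^ p)
        ∂(volume.withDensity fun y => ENNReal.ofReal (alphaMuPdf α μ l y)) =
      ENNReal.ofReal (Real.Gamma (μ + p / α) / Real.Gamma μ * (c / l) ^ p) := by
  have hΓ := Real.Gamma_pos_of_pos hμ
  have hq : -1 < p + α * μ - 1 := by nlinarith [mul_pos hα hμ]
  have hb : 0 < l ^ α := by positivity
  rw [lintegral_withDensity_eq_lintegral_mul₀ (by fun_prop) (by fun_prop)]
  have hind : ((fun y => ENNReal.ofReal (alphaMuPdf α μ l y)) *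
      fun y => ENNReal.ofReal ((c * y) ^ p)) =
      (Ioi 0).indicator (fun y => ENNReal.ofReal (c ^ p * (α * l ^ (α * μ) / Real.Gamma μ) *
        (y ^ (p + α * μ - 1) * Real.exp (-l ^ α * y ^ α)))) := by
    ext y
    by_cases hy : 0 < y
    · have h0 : 0 ≤ alphaMuPdf α μ l y := by
        simp only [alphaMuPdf, hy, if_true]
        positivity
      simp only [Pi.mul_apply, mem_Ioi, hy, indicator_of_mem]
      rw [← ENNReal.ofReal_mul h0]
      simp only [alphaMuPdf, hy, if_true]
      rw [Real.mul_rpow hc.le hy.le, Real.mul_rpow hl.le hy.le,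
        show p + α * μ - 1 = p + (α * μ - 1) by ring, Real.rpow_add hy, neg_mul]
      congr 1
      ring
    · simp [alphaMuPdf, hy]
  rw [hind, lintegral_indicator measurableSet_Ioi,
    ← ofReal_integral_eq_lintegral_ofReal
      ((integrableOn_rpow_mul_exp_neg_mul_rpow hq hα hb).const_mul _),
    integral_const_mul, integral_rpow_mul_exp_neg_mul_rpow hα hq hb]
  · congr 1
    rw [← Real.rpow_mul hl.le, Real.div_rpow hc.le hl.le,
      show α * (-(p + α * μ - 1 + 1) / α) = -p + -(α * μ) by field_simp; ring,
      show (p + α * μ - 1 + 1) / α = μ + p / α by field_simp; ring,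
      Real.rpow_add hl, Real.rpow_neg hl.le, Real.rpow_neg hl.le]
    field_simp
  · filter_upwards [ae_restrict_mem measurableSet_Ioi] with y hy
    have : 0 < y := hy
    simp only [Pi.zero_apply]
    positivity

lemma measure_le_mul_eq_lintegral {Ω : Type*} [MeasurableSpace Ω] {μ : Measure Ω}
    [IsProbabilityMeasure μ] {X Y : Ω → ℝ} {f : ℝ → ℝ} (hf : Measurable f)
    (hX : HasDensity μ X f) (hY : Measurable Y) (h : ProbabilityTheory.IndepFun X Y μ) (r : ℝ) :
    μ {ω | X ω ≤ r * Y ω} = ∫⁻ z in {z : ℝ × ℝ | z.1 ≤ r * z.2}, ENNReal.ofReal (f z.1)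
      ∂(volume.prod (μ.map Y)) := by
  have hS : MeasurableSet {z : ℝ × ℝ | z.1 ≤ r * z.2} :=
    measurableSet_le (by fun_prop) (by fun_prop)
  have : μ {ω | X ω ≤ r * Y ω} =
      μ.map (fun ω => (X ω, Y ω)) {z : ℝ × ℝ | z.1 ≤ r * z.2} := by
    rw [Measure.map_apply (hX.1.prodMk hY) hS]
    rfl
  rw [this, (ProbabilityTheory.indepFun_iff_map_prod_eq_prod_map_map hX.1.aemeasurable
    hY.aemeasurable).1 h, hX.2, prod_withDensity_left (by fun_prop), withDensity_apply _ hS]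

lemma setLIntegral_alphaMuEnvelope {αB μB αE μE lamE r : ℝ}
    (hαB : 0 < αB) (hμB : 0 < μB) (hαE : 0 < αE) (hμE : 0 < μE) (hlamE : 0 < lamE) (hr : 0 < r)
    {ν : Measure ℝ} [SFinite ν]
    (hν : ν = volume.withDensity fun y => ENNReal.ofReal (alphaMuPdf αE μE lamE y)) :
    ∫⁻ z in {z : ℝ × ℝ | z.1 ≤ r * z.2}, ENNReal.ofReal (alphaMuEnvelope αB μB z.1)
        ∂(volume.prod ν) =
      ENNReal.ofReal (Real.Gamma (μE + αB * μB / αE) / (Real.Gamma (1 + μB) * Real.Gamma μE) *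
        (r / lamE) ^ (αB * μB)) := by
  have hS : MeasurableSet {z : ℝ × ℝ | z.1 ≤ r * z.2} :=
    measurableSet_le (by fun_prop) (by fun_prop)
  have hΓ : 0 < Real.Gamma (1 + μB) := Real.Gamma_pos_of_pos (by linarith)
  have hpos : ∀ᵐ y ∂ν, 0 < y := by
    rw [hν, ae_withDensity_iff (by fun_prop)]
    refine Eventually.of_forall fun y hy => ?_
    by_contra h
    exact hy (by simp [alphaMuPdf, h])
  rw [← withDensity_apply _ hS, ← prod_withDensity_left
      (f := fun x => ENNReal.ofReal (alphaMuEnvelope αB μB x)) (by fun_prop),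
    Measure.prod_apply_symm hS]
  calc _ = ∫⁻ y, ENNReal.ofReal (Real.Gamma (1 + μB))⁻¹ *
        ENNReal.ofReal ((r * y) ^ (αB * μB)) ∂ν := by
        refine lintegral_congr_ae (hpos.mono fun y hy => ?_)
        refine (withDensity_alphaMuEnvelope_Iic hαB hμB (mul_pos hr hy)).trans ?_
        beta_reduce
        rw [← ENNReal.ofReal_mul (by positivity), div_eq_inv_mul]
    _ = _ := by
        rw [lintegral_const_mul _ (by fun_prop), hν,
          lintegral_rpow_withDensity_alphaMuPdf hαE hμE hlamE (by positivity) hr,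
          ← ENNReal.ofReal_mul (by positivity)]
        congr 1
        field_simp

/-- **Asymptotic secrecy outage probability over α-μ wiretap fading channels (eq. (25)).**
With `Y` α-μ distributed with parameters `(α_E, μ_E, λ_E)` and, for each `λ_B > 0`,
`X_{λ_B}` α-μ distributed with parameters `(α_B, μ_B, λ_B)` and independent of `Y`,
`lim_{λ_B → 0⁺} Pr(X_{λ_B} ≤ R_s Y)/λ_B^{α_B μ_B}
  = [Γ(μ_E + α_B μ_B/α_E)/(Γ(1+μ_B) Γ(μ_E))] (R_s/λ_E)^{α_B μ_B}`. -/
theorem sop_asymptotic_alphaMu {Ω : Type*} [MeasurableSpace Ω] (μ : Measure Ω)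
    [IsProbabilityMeasure μ]
    (αB μB αE μE lamE Rs : ℝ)
    (hαB : 0 < αB) (hμB : 0 < μB) (hαE : 0 < αE) (hμE : 0 < μE) (hlamE : 0 < lamE)
    (hRs : 1 ≤ Rs)
    (Y : Ω → ℝ) (hY : HasDensity μ Y (alphaMuPdf αE μE lamE))
    (X : ℝ → Ω → ℝ)
    (hX : ∀ l : ℝ, 0 < l → HasDensity μ (X l) (alphaMuPdf αB μB l) ∧
      ProbabilityTheory.IndepFun (X l) Y μ) :
    Tendsto (fun l : ℝ => (μ {ω | X l ω ≤ Rs * Y ω}).toReal / l ^ (αB * μB))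
      (nhdsWithin 0 (Ioi 0))
      (nhds (Real.Gamma (μE + αB * μB / αE) / (Real.Gamma (1 + μB) * Real.Gamma μE) *
        (Rs / lamE) ^ (αB * μB))) := by
  have hr : 0 < Rs := by linarith
  have : IsProbabilityMeasure (μ.map Y) := Measure.isProbabilityMeasure_map hY.1.aemeasurable
  have hlim := setLIntegral_alphaMuEnvelope hαB hμB hαE hμE hlamE hr hY.2
  set L := Real.Gamma (μE + αB * μB / αE) / (Real.Gamma (1 + μB) * Real.Gamma μE) *
    (Rs / lamE) ^ (αB * μB)
  have hL0 : 0 ≤ L := by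
    have h1 : 0 < Real.Gamma (μE + αB * μB / αE) := Real.Gamma_pos_of_pos (by positivity)
    have h2 : 0 < Real.Gamma (1 + μB) := Real.Gamma_pos_of_pos (by positivity)
    have h3 := Real.Gamma_pos_of_pos hμE
    positivity
  have key : Tendsto (fun l : ℝ => ∫⁻ z in {z : ℝ × ℝ | z.1 ≤ Rs * z.2},
      ENNReal.ofReal (alphaMuEnvelope αB μB z.1 * Real.exp (-(l * z.1) ^ αB))
        ∂(volume.prod (μ.map Y))) (nhdsWithin 0 (Ioi 0)) (nhds (ENNReal.ofReal L)) := by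
    rw [← hlim]
    refine tendsto_lintegral_filter_of_dominated_convergence
      (fun z => ENNReal.ofReal (alphaMuEnvelope αB μB z.1)) ?_ ?_ ?_ ?_
    · exact Eventually.of_forall fun l => by fun_prop
    · filter_upwards [self_mem_nhdsWithin] with l hl
      exact ae_of_all _ fun z =>
        ENNReal.ofReal_le_ofReal (alphaMuEnvelope_mul_exp_le hαB hμB hl z.1)
    · rw [hlim]
      exact ENNReal.ofReal_ne_top
    · exact ae_of_all _ fun z =>
        ENNReal.tendsto_ofReal (tendsto_alphaMuEnvelope_mul_exp μB hαB z.1)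
  have key' := (ENNReal.tendsto_toReal ENNReal.ofReal_ne_top).comp key
  rw [ENNReal.toReal_ofReal hL0] at key'
  refine key'.congr' ?_
  filter_upwards [self_mem_nhdsWithin] with l hl
  have hlp : 0 < l ^ (αB * μB) := Real.rpow_pos_of_pos hl _
  rw [measure_le_mul_eq_lintegral (measurable_alphaMuPdf αB μB l) (hX l hl).1 hY.1 (hX l hl).2]
  simp_rw [alphaMuPdf_eq_rpow_mul, ENNReal.ofReal_mul hlp.le]
  rw [lintegral_const_mul _ (by fun_prop), ENNReal.toReal_mul, ENNReal.toReal_ofReal hlp.le,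
    mul_div_cancel_left₀ _ hlp.ne', Function.comp_apply]
end
end
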